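/- arXiv:2302.14744 — 14 statements merged into one kernel-verified Lean document; each statement's English description precedes it below -/
import Mathlib

section
/- Suppose b_{l,i} ≤ u_{l,i} for every l ∈ {1,…,p} and i ∈ {1,…,d}. Then the projected formulation Q^proj is ideal: every extreme point (w, y, z) of the polyhedron Q^proj satisfies z_l ∈ {0,1} for every l ∈ {1,…,p}. -/
open Finset

/-- A number between two linear forms with ordered coefficients, evaluated at the same point,
is the value there of a linear form whose coefficients lie in between. -/
lemma exists_sum_mul_eq_of_mem_Icc {ι : Type*} [Fintype ι] {b u z : ι → ℝ} (hbu : b ≤ u) {w : ℝ}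
    (hw : w ∈ Set.Icc (∑ l, b l * z l) (∑ l, u l * z l)) :
    ∃ c ∈ Set.Icc b u, ∑ l, c l * z l = w := by
  rw [← segment_eq_Icc (hw.1.trans hw.2)] at hw
  obtain ⟨α, β, hα, hβ, hαβ, rfl⟩ := hw
  refine ⟨α • b + β • u, segment_subset_Icc hbu ⟨α, β, hα, hβ, hαβ, rfl⟩, ?_⟩
  simp only [Pi.add_apply, Pi.smul_apply, smul_eq_mul, add_mul, mul_assoc, sum_add_distrib,
    mul_sum]

/-- A point of the standard simplex is a convex combination of any vertex at which its
coordinate is less than one and another point of the simplex. -/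
lemma exists_mem_stdSimplex_eq_smul_single_add {ι : Type*} [Fintype ι] [DecidableEq ι]
    {z : ι → ℝ} (hz : z ∈ stdSimplex ℝ ι) {k : ι} (hk : z k < 1) :
    ∃ x ∈ stdSimplex ℝ ι, z = z k • Pi.single k 1 + (1 - z k) • x := by
  have hpos : 0 < 1 - z k := sub_pos.2 hk
  refine ⟨(1 - z k)⁻¹ • (z - z k • Pi.single k 1), ⟨fun l => ?_, ?_⟩, ?_⟩
  · refine mul_nonneg (inv_nonneg.2 hpos.le) ?_
    by_cases h : l = k
    · subst h; simp
    · simpa [h] using hz.1 l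
  · simp [← mul_sum, sum_sub_distrib, hz.2, hpos.ne']
  · rw [smul_inv_smul₀ hpos.ne']
    abel

/-- If `b l i ≤ u l i` for all leaves `l` and features `i`, then the projected
formulation `Qproj` is ideal: every extreme point `(w, y, z)` of `Qproj` has `z l ∈ {0, 1}`
for every leaf `l`. -/
theorem qproj_ideal (d p : ℕ) (hd : 0 < d) (hp : 0 < p)
    (u b : Fin p → Fin d → ℝ) (s : Fin p → ℝ)
    (hbu : ∀ l i, b l i ≤ u l i)
    (Qproj : Set ((Fin d → ℝ) × ℝ × (Fin p → ℝ)))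
    (hQ : Qproj = {q | (∀ i, q.1 i ≤ ∑ l, u l i * q.2.2 l) ∧
        (∀ i, ∑ l, b l i * q.2.2 l ≤ q.1 i) ∧
        (q.2.1 = ∑ l, s l * q.2.2 l) ∧
        (∑ l, q.2.2 l = 1) ∧
        (∀ l, 0 ≤ q.2.2 l ∧ q.2.2 l ≤ 1)})
    (v : (Fin d → ℝ) × ℝ × (Fin p → ℝ)) (hv : v ∈ Qproj)
    (hext : ∀ a ∈ Qproj, ∀ b' ∈ Qproj, ∀ t : ℝ, 0 < t → t < 1 →
      v = t • a + (1 - t) • b' → a = v ∧ b' = v) :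
    ∀ l, v.2.2 l = 0 ∨ v.2.2 l = 1 := by
  subst hQ
  obtain ⟨w, y, z⟩ := v
  obtain ⟨hwu, hbw, hy, hsum, hz⟩ := hv
  dsimp only at hwu hbw hy hsum hz ⊢
  choose c hc hcw using fun i => exists_sum_mul_eq_of_mem_Icc
    (b := fun l => b l i) (u := fun l => u l i) (fun l => hbu l i) ⟨hbw i, hwu i⟩
  have hmem : ∀ x ∈ stdSimplex ℝ (Fin p),
      ((fun i => ∑ l, c i l * x l, ∑ l, s l * x l, x) : (Fin d → ℝ) × ℝ × (Fin p → ℝ)) ∈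
        {q : (Fin d → ℝ) × ℝ × (Fin p → ℝ) | (∀ i, q.1 i ≤ ∑ l, u l i * q.2.2 l) ∧
          (∀ i, ∑ l, b l i * q.2.2 l ≤ q.1 i) ∧
          (q.2.1 = ∑ l, s l * q.2.2 l) ∧
          (∑ l, q.2.2 l = 1) ∧
          (∀ l, 0 ≤ q.2.2 l ∧ q.2.2 l ≤ 1)} := by
    intro x hx
    refine ⟨fun i => ?_, fun i => ?_, rfl, hx.2, fun l => mem_Icc_of_mem_stdSimplex hx l⟩
    · dsimp only
      exact sum_le_sum fun l _ => mul_le_mul_of_nonneg_right ((hc i).2 l) (hx.1 l)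
    · exact sum_le_sum fun l _ => mul_le_mul_of_nonneg_right ((hc i).1 l) (hx.1 l)
  intro k
  by_contra! hk
  have hk1 : z k < 1 := lt_of_le_of_ne (hz k).2 hk.2
  obtain ⟨x, hx, hzx⟩ := exists_mem_stdSimplex_eq_smul_single_add ⟨fun l => (hz l).1, hsum⟩ hk1
  have hlin : ∀ f : Fin p → ℝ, ∑ l, f l * z l =
      z k * ∑ l, f l * (Pi.single k 1 : Fin p → ℝ) l + (1 - z k) * ∑ l, f l * x l := by
    intro f
    rw [mul_sum, mul_sum, ← sum_add_distrib]
    refine sum_congr rfl fun l _ => ?_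
    have hl : z l = z k * (Pi.single k 1 : Fin p → ℝ) l + (1 - z k) * x l := congrFun hzx l
    rw [hl]
    ring
  have hvertex := (hext _ (hmem _ (single_mem_stdSimplex ℝ k)) _ (hmem x hx) (z k)
    (lt_of_le_of_ne (hz k).1 hk.1.symm) hk1
    (Prod.ext (funext fun i => (hcw i).symm.trans (hlin (c i)))
      (Prod.ext (hy.trans (hlin s)) hzx))).1
  have hcoord : (Pi.single k 1 : Fin p → ℝ) k = z k := congrArg (fun q => q.2.2 k) hvertex
  exact hk.2 (by simpa using hcoord.symm)
end

section
/- Suppose b_{l,i} ≤ u_{l,i} for every l ∈ {1,…,p} and i ∈ {1,…,d}. Then the image of Q^ext under the coordinate projection (w, y, (w^l)_{l=1}^p, (y^l)_{l=1}^p, z) ↦ (w, y, z) is exactly the polyhedron Q^proj; that is, Fourier–Motzkin elimination of the copy variables w^l and y^l from the extended union-of-polyhedra formulation yields the projected formulation. -/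
open Finset

/-- A real number between the sums of `f ≤ g` is the sum of a function between `f` and `g`. -/
theorem exists_between_sum_eq {ι : Type*} [Fintype ι] {f g : ι → ℝ} (hfg : ∀ l, f l ≤ g l)
    {c : ℝ} (hf : ∑ l, f l ≤ c) (hg : c ≤ ∑ l, g l) :
    ∃ h : ι → ℝ, (∀ l, f l ≤ h l) ∧ (∀ l, h l ≤ g l) ∧ c = ∑ l, h l := by
  have hc : c ∈ segment ℝ (∑ l, f l) (∑ l, g l) := Icc_subset_segment ⟨hf, hg⟩
  obtain ⟨α, β, hα, hβ, hαβ, rfl⟩ := hc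
  obtain rfl : α = 1 - β := by linarith
  refine ⟨fun l => (1 - β) * f l + β * g l, fun l => ?_, fun l => ?_, ?_⟩
  · nlinarith [mul_nonneg hβ (sub_nonneg.2 (hfg l))]
  · nlinarith [mul_nonneg hα (sub_nonneg.2 (hfg l))]
  · simp only [smul_eq_mul, Finset.mul_sum, Finset.sum_add_distrib]

/-- If `b l i ≤ u l i` for all `l, i`, then the image of the extended
union-of-polyhedra formulation `Qext` under the coordinate projection
`(w, y, (wˡ)ₗ, (yˡ)ₗ, z) ↦ (w, y, z)` is exactly the projected formulation `Qproj`. -/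
theorem qext_projects_to_qproj (d p : ℕ) (hd : 0 < d) (hp : 0 < p)
    (u b : Fin p → Fin d → ℝ) (s : Fin p → ℝ)
    (hbu : ∀ l i, b l i ≤ u l i)
    (Qext : Set ((Fin d → ℝ) × ℝ × (Fin p → Fin d → ℝ) × (Fin p → ℝ) × (Fin p → ℝ)))
    (hQext : Qext = {q | (∀ l i, q.2.2.1 l i ≤ u l i * q.2.2.2.2 l) ∧
        (∀ l i, b l i * q.2.2.2.2 l ≤ q.2.2.1 l i) ∧
        (∀ l, q.2.2.2.1 l = s l * q.2.2.2.2 l) ∧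
        (∑ l, q.2.2.2.2 l = 1) ∧
        (∀ i, q.1 i = ∑ l, q.2.2.1 l i) ∧
        (q.2.1 = ∑ l, q.2.2.2.1 l) ∧
        (∀ l, 0 ≤ q.2.2.2.2 l ∧ q.2.2.2.2 l ≤ 1)})
    (Qproj : Set ((Fin d → ℝ) × ℝ × (Fin p → ℝ)))
    (hQproj : Qproj = {q | (∀ i, q.1 i ≤ ∑ l, u l i * q.2.2 l) ∧
        (∀ i, ∑ l, b l i * q.2.2 l ≤ q.1 i) ∧
        (q.2.1 = ∑ l, s l * q.2.2 l) ∧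
        (∑ l, q.2.2 l = 1) ∧
        (∀ l, 0 ≤ q.2.2 l ∧ q.2.2 l ≤ 1)}) :
    (fun q : (Fin d → ℝ) × ℝ × (Fin p → Fin d → ℝ) × (Fin p → ℝ) × (Fin p → ℝ) =>
      (q.1, q.2.1, q.2.2.2.2)) '' Qext = Qproj := by
  subst hQext hQproj
  ext ⟨w, y, z⟩
  constructor
  · rintro ⟨⟨w₀, y₀, W, Y, z₀⟩, ⟨hu, hb, hY, hz, hw, hy, hz01⟩, heq⟩
    obtain ⟨rfl, rfl, rfl⟩ : w₀ = w ∧ y₀ = y ∧ z₀ = z := by simpa using heq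
    refine ⟨fun i => ?_, fun i => ?_, hy.trans (Finset.sum_congr rfl fun l _ => hY l), hz, hz01⟩
    · exact (hw i).trans_le (Finset.sum_le_sum fun l _ => hu l i)
    · exact (Finset.sum_le_sum fun l _ => hb l i).trans_eq (hw i).symm
  · rintro ⟨hu, hb, hy, hz, hz01⟩
    choose W hbW hWu hW using fun i => exists_between_sum_eq
      (fun l => mul_le_mul_of_nonneg_right (hbu l i) (hz01 l).1) (hb i) (hu i)
    exact ⟨(w, y, fun l i => W i l, fun l => s l * z l, z),
      ⟨fun l i => hWu i l, fun l i => hbW i l, fun _ => rfl, hz, hW, hy, hz01⟩, rfl⟩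
end

section
/- Assume b_{l,i} ≤ u_{l,i} for every l ∈ {1,…,p} and i ∈ {1,…,d} (every leaf box is nonempty), and assume there exists k ∈ {1,…,p} with b_{k,i} < u_{k,i} for every i ∈ {1,…,d} (some leaf box is full-dimensional). Then for every i ∈ {1,…,d} the inequality b_{p,i} + ∑_{l=1}^{p−1}(b_{l,i} − b_{p,i}) z_l ≤ w_i is facet-defining for Q^facet: the face F_i = {(w, y, z) ∈ Q^facet : b_{p,i} + ∑_{l=1}^{p−1}(b_{l,i} − b_{p,i}) z_l = w_i} satisfies dim(F_i) = dim(Q^facet) − 1. The analogous statement holds for the upper-bound inequality u_{p,i} + ∑_{l=1}^{p−1}(u_{l,i} − u_{p,i}) z_l ≥ w_i. -/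
open Finset

/-- If `S` lies in `x + D` and contains a nonzero multiple of every direction of `D` issued from
`x ∈ S`, then `D` is the direction of the affine span of `S`. -/
theorem direction_affineSpan_eq_of_relInterior {E : Type*} [AddCommGroup E] [Module ℝ E]
    {S : Set E} {D : Submodule ℝ E} {x : E} (hx : x ∈ S) (hS : ∀ y ∈ S, y - x ∈ D)
    (hD : ∀ v ∈ D, ∀ᶠ t in nhds (0 : ℝ), x + t • v ∈ S) :
    (affineSpan ℝ S).direction = D := by
  rw [direction_affineSpan]
  apply le_antisymm
  · rw [vectorSpan_eq_span_vsub_set_right ℝ hx, Submodule.span_le]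
    rintro _ ⟨y, hy, rfl⟩
    exact hS y hy
  · intro v hv
    obtain ⟨t, ht, ht0⟩ := (((hD v hv).filter_mono nhdsWithin_le_nhds).and
      (self_mem_nhdsWithin : {(0 : ℝ)}ᶜ ∈ nhdsWithin 0 {0}ᶜ)).exists
    have h : t • v ∈ vectorSpan ℝ S := by
      simpa using vsub_mem_vectorSpan ℝ ht hx
    exact (Submodule.smul_mem_iff _ ht0).1 h

theorem finrank_inf_ker_eq_sub_one {E : Type*} [AddCommGroup E] [Module ℝ E]
    [FiniteDimensional ℝ E] (D : Submodule ℝ E) (φ : E →ₗ[ℝ] ℝ) {v : E} (hv : v ∈ D)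
    (hφ : φ v ≠ 0) :
    Module.finrank ℝ ↥(D ⊓ LinearMap.ker φ) = Module.finrank ℝ D - 1 := by
  have hne : φ.domRestrict D ≠ 0 := fun h => hφ (by simpa using congrArg (· ⟨v, hv⟩) h)
  have h := Module.Dual.finrank_ker_add_one_of_ne_zero (f := φ.domRestrict D) hne
  have e : D ⊓ LinearMap.ker φ = (LinearMap.ker (φ.domRestrict D)).map D.subtype := by
    ext x
    simp [LinearMap.mem_ker, and_comm]
  rw [e, Submodule.finrank_map_subtype_eq]
  omega

/-- The linear part of the affine function of the leaf variables taking the value `a l` at the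
vertex of leaf `l`, the last leaf being the origin. -/
def leafSlope {m : ℕ} (a : Fin (m + 1) → ℝ) : (Fin m → ℝ) →ₗ[ℝ] ℝ :=
  ∑ l : Fin m, (a l.castSucc - a (Fin.last m)) • LinearMap.proj l

theorem leafSlope_apply {m : ℕ} (a : Fin (m + 1) → ℝ) (z : Fin m → ℝ) :
    leafSlope a z = ∑ l : Fin m, (a l.castSucc - a (Fin.last m)) * z l := by
  simp [leafSlope]

theorem leafSlope_barycenter {m : ℕ} (a : Fin (m + 1) → ℝ) :
    a (Fin.last m) + leafSlope a (fun _ => ((m : ℝ) + 1)⁻¹) = (∑ l, a l) / (m + 1) := by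
  have hm : (m : ℝ) + 1 ≠ 0 := by positivity
  rw [leafSlope_apply, ← Finset.sum_mul, Finset.sum_sub_distrib, Fin.sum_univ_castSucc]
  simp only [Finset.sum_const, Finset.card_univ, Fintype.card_fin, nsmul_eq_mul]
  field_simp
  ring

theorem eventually_lt_add_mul {x y : ℝ} (h : x < y) (a c : ℝ) :
    ∀ᶠ t in nhds (0 : ℝ), x + t * a < y + t * c :=
  Filter.Tendsto.eventually_lt (f := fun t : ℝ => x + t * a) (g := fun t : ℝ => y + t * c)
    (y := x) (z := y)
    (Continuous.tendsto' (by fun_prop) _ _ (by simp))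
    (Continuous.tendsto' (by fun_prop) _ _ (by simp)) h

/-- The polyhedron with leaf bounds `b`, `u` and scores `s`, in the variables `(w, y, z)`. -/
def leafPolyhedron {d m : ℕ} (u b : Fin (m + 1) → Fin d → ℝ) (s : Fin (m + 1) → ℝ) :
    Set ((Fin d → ℝ) × ℝ × (Fin m → ℝ)) :=
  {q | (∀ i, q.1 i ≤ u (Fin.last m) i + leafSlope (u · i) q.2.2) ∧
    (∀ i, b (Fin.last m) i + leafSlope (b · i) q.2.2 ≤ q.1 i) ∧
    q.2.1 = s (Fin.last m) + leafSlope s q.2.2 ∧ ∀ l, 0 ≤ q.2.2 l ∧ q.2.2 l ≤ 1}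

/-- The linear form `w i - leafSlope c z`. -/
def boundForm {d m : ℕ} (i : Fin d) (c : Fin (m + 1) → ℝ) :
    ((Fin d → ℝ) × ℝ × (Fin m → ℝ)) →ₗ[ℝ] ℝ :=
  (LinearMap.proj i : (Fin d → ℝ) →ₗ[ℝ] ℝ) ∘ₗ LinearMap.fst ℝ _ _ -
    leafSlope c ∘ₗ LinearMap.snd ℝ _ _ ∘ₗ LinearMap.snd ℝ _ _

/-- The linear form `y - leafSlope s z`. -/
def scoreForm {m : ℕ} (d : ℕ) (s : Fin (m + 1) → ℝ) :
    ((Fin d → ℝ) × ℝ × (Fin m → ℝ)) →ₗ[ℝ] ℝ :=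
  LinearMap.fst ℝ _ _ ∘ₗ LinearMap.snd ℝ _ _ -
    leafSlope s ∘ₗ LinearMap.snd ℝ _ _ ∘ₗ LinearMap.snd ℝ _ _

theorem mem_ker_boundForm {d m : ℕ} {i : Fin d} {c : Fin (m + 1) → ℝ}
    {v : (Fin d → ℝ) × ℝ × (Fin m → ℝ)} :
    v ∈ LinearMap.ker (boundForm i c) ↔ v.1 i = leafSlope c v.2.2 := by
  simp [boundForm, sub_eq_zero]

theorem mem_ker_scoreForm {d m : ℕ} {s : Fin (m + 1) → ℝ}
    {v : (Fin d → ℝ) × ℝ × (Fin m → ℝ)} :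
    v ∈ LinearMap.ker (scoreForm d s) ↔ v.2.1 = leafSlope s v.2.2 := by
  simp [scoreForm, sub_eq_zero]

/-- Moving from a point of the polyhedron along a direction which preserves the score equation
and every bound that is tight stays in the polyhedron for a while. -/
theorem eventually_add_smul_mem_leafPolyhedron {d m : ℕ} {u b : Fin (m + 1) → Fin d → ℝ}
    {s : Fin (m + 1) → ℝ} {q v : (Fin d → ℝ) × ℝ × (Fin m → ℝ)}
    (hu : ∀ i, q.1 i < u (Fin.last m) i + leafSlope (u · i) q.2.2 ∨
      q.1 i = u (Fin.last m) i + leafSlope (u · i) q.2.2 ∧ v.1 i = leafSlope (u · i) v.2.2)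
    (hb : ∀ i, b (Fin.last m) i + leafSlope (b · i) q.2.2 < q.1 i ∨
      b (Fin.last m) i + leafSlope (b · i) q.2.2 = q.1 i ∧ leafSlope (b · i) v.2.2 = v.1 i)
    (hs : q.2.1 = s (Fin.last m) + leafSlope s q.2.2)
    (hz : ∀ l, 0 < q.2.2 l ∧ q.2.2 l < 1) (hv : v.2.1 = leafSlope s v.2.2) :
    ∀ᶠ t in nhds (0 : ℝ), q + t • v ∈ leafPolyhedron u b s := by
  have bound {x y a c : ℝ} (h : x < y ∨ x = y ∧ a = c) :
      ∀ᶠ t in nhds (0 : ℝ), x + t * a ≤ y + t * c := by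
    rcases h with h | ⟨rfl, rfl⟩
    · exact (eventually_lt_add_mul h a c).mono fun _ => le_of_lt
    · exact Filter.Eventually.of_forall fun _ => le_rfl
  have hu' := Filter.eventually_all.2 fun i => bound (hu i)
  have hb' := Filter.eventually_all.2 fun i => bound (hb i)
  have h0 := Filter.eventually_all.2 fun l => eventually_lt_add_mul (hz l).1 0 (v.2.2 l)
  have h1 := Filter.eventually_all.2 fun l => eventually_lt_add_mul (hz l).2 (v.2.2 l) 0
  filter_upwards [hu', hb', h0, h1] with t hu' hb' h0 h1
  simp only [leafPolyhedron, Set.mem_ofPred_eq, Prod.fst_add, Prod.snd_add, Prod.smul_fst,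
    Prod.smul_snd, Pi.add_apply, Pi.smul_apply, map_add, map_smul, smul_eq_mul]
  refine ⟨fun i => by linarith [hu' i], fun i => by linarith [hb' i], by rw [hs, hv]; ring,
    fun l => ⟨by linarith [h0 l], by linarith [h1 l]⟩⟩

theorem exists_strict_leaf_weights {d m : ℕ} {u b : Fin (m + 1) → Fin d → ℝ}
    (hbu : ∀ l i, b l i ≤ u l i) (hfull : ∃ k : Fin (m + 1), ∀ i, b k i < u k i) :
    ∃ z : Fin m → ℝ, (∀ l, 0 < z l ∧ z l < 1) ∧ ∀ i,
      b (Fin.last m) i + leafSlope (b · i) z < u (Fin.last m) i + leafSlope (u · i) z := by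
  obtain ⟨k, hk⟩ := hfull
  refine ⟨fun _ => ((m : ℝ) + 1)⁻¹, fun l => ⟨by positivity, ?_⟩, fun i => ?_⟩
  · have : (0 : ℝ) < m := by exact_mod_cast l.pos
    exact inv_lt_one_of_one_lt₀ (by linarith)
  · rw [leafSlope_barycenter (b · i), leafSlope_barycenter (u · i)]
    have := Finset.sum_lt_sum (fun l _ => hbu l i) ⟨k, Finset.mem_univ k, hk i⟩
    gcongr

theorem direction_affineSpan_leafPolyhedron {d m : ℕ} {u b : Fin (m + 1) → Fin d → ℝ}
    (s : Fin (m + 1) → ℝ)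
    (hbu : ∀ l i, b l i ≤ u l i) (hfull : ∃ k : Fin (m + 1), ∀ i, b k i < u k i) :
    (affineSpan ℝ (leafPolyhedron u b s)).direction = LinearMap.ker (scoreForm d s) := by
  obtain ⟨z, hz, hlt⟩ := exists_strict_leaf_weights hbu hfull
  choose w hw using fun i => exists_between (hlt i)
  let q : (Fin d → ℝ) × ℝ × (Fin m → ℝ) := (w, s (Fin.last m) + leafSlope s z, z)
  apply direction_affineSpan_eq_of_relInterior (x := q)
  · exact ⟨fun i => (hw i).2.le, fun i => (hw i).1.le, rfl,
      fun l => ⟨(hz l).1.le, (hz l).2.le⟩⟩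
  · rintro y ⟨-, -, hy, -⟩
    rw [mem_ker_scoreForm]
    simp only [Prod.snd_sub, Prod.fst_sub, map_sub, hy, q]
    ring
  · intro v hv
    exact eventually_add_smul_mem_leafPolyhedron (fun i => .inl (hw i).2)
      (fun i => .inl (hw i).1) rfl hz (mem_ker_scoreForm.1 hv)

theorem direction_affineSpan_face_leafPolyhedron {d m : ℕ} {u b : Fin (m + 1) → Fin d → ℝ}
    (s : Fin (m + 1) → ℝ)
    (hbu : ∀ l i, b l i ≤ u l i) (hfull : ∃ k : Fin (m + 1), ∀ i, b k i < u k i)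
    (i : Fin d) {c : Fin (m + 1) → ℝ} (hc : c = (b · i) ∨ c = (u · i)) :
    (affineSpan ℝ {q ∈ leafPolyhedron u b s |
      c (Fin.last m) + leafSlope c q.2.2 = q.1 i}).direction =
      LinearMap.ker (scoreForm d s) ⊓ LinearMap.ker (boundForm i c) := by
  obtain ⟨z, hz, hlt⟩ := exists_strict_leaf_weights hbu hfull
  choose w hw using fun i => exists_between (hlt i)
  let q : (Fin d → ℝ) × ℝ × (Fin m → ℝ) :=
    (Function.update w i (c (Fin.last m) + leafSlope c z), s (Fin.last m) + leafSlope s z, z)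
  have hqi : c (Fin.last m) + leafSlope c q.2.2 = q.1 i := by simp [q]
  have hev : ∀ v ∈ LinearMap.ker (scoreForm d s) ⊓ LinearMap.ker (boundForm i c),
      ∀ᶠ t in nhds (0 : ℝ), q + t • v ∈ {q ∈ leafPolyhedron u b s |
        c (Fin.last m) + leafSlope c q.2.2 = q.1 i} := by
    intro v hv
    have hvs := mem_ker_scoreForm.1 hv.1
    have hvi := mem_ker_boundForm.1 hv.2
    have hmem : ∀ᶠ t in nhds (0 : ℝ), q + t • v ∈ leafPolyhedron u b s := by
      refine eventually_add_smul_mem_leafPolyhedron (fun j => ?_) (fun j => ?_) rfl hz hvs <;>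
        rcases eq_or_ne j i with rfl | hj
      · rcases hc with rfl | rfl
        · exact .inl (hqi ▸ hlt j)
        · exact .inr ⟨hqi.symm, hvi⟩
      · exact .inl (by simpa [q, hj] using (hw j).2)
      · rcases hc with rfl | rfl
        · exact .inr ⟨hqi, hvi.symm⟩
        · exact .inl (hqi ▸ hlt j)
      · exact .inl (by simpa [q, hj] using (hw j).1)
    filter_upwards [hmem] with t ht
    refine ⟨ht, ?_⟩
    simp only [Prod.fst_add, Prod.snd_add, Prod.smul_fst, Prod.smul_snd, Pi.add_apply,
      Pi.smul_apply, map_add, map_smul, smul_eq_mul, hvi, ← hqi]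
    ring
  refine direction_affineSpan_eq_of_relInterior (x := q) ?_ ?_ hev
  · simpa using (hev 0 (zero_mem _)).self_of_nhds
  · rintro y ⟨⟨-, -, hy, -⟩, hyi⟩
    refine ⟨mem_ker_scoreForm.2 ?_, mem_ker_boundForm.2 ?_⟩
    · simp only [Prod.snd_sub, Prod.fst_sub, map_sub, hy, q]
      ring
    · simp only [Prod.snd_sub, Prod.fst_sub, map_sub, Pi.sub_apply, ← hyi, ← hqi]
      ring

theorem finrank_face_leafPolyhedron {d m : ℕ} {u b : Fin (m + 1) → Fin d → ℝ}
    (s : Fin (m + 1) → ℝ)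
    (hbu : ∀ l i, b l i ≤ u l i) (hfull : ∃ k : Fin (m + 1), ∀ i, b k i < u k i)
    (i : Fin d) {c : Fin (m + 1) → ℝ} (hc : c = (b · i) ∨ c = (u · i)) :
    Module.finrank ℝ (affineSpan ℝ {q ∈ leafPolyhedron u b s |
      c (Fin.last m) + leafSlope c q.2.2 = q.1 i}).direction =
      Module.finrank ℝ (affineSpan ℝ (leafPolyhedron u b s)).direction - 1 := by
  rw [direction_affineSpan_face_leafPolyhedron s hbu hfull i hc,
    direction_affineSpan_leafPolyhedron s hbu hfull]
  exact finrank_inf_ker_eq_sub_one _ _ (v := (Pi.single i 1, 0, 0))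
    (mem_ker_scoreForm.2 (by simp)) (by simp [boundForm])

/-- For the reduced formulation `Qfacet` (with `p = m + 1` leaves and `m` leaf
variables, the last leaf eliminated), if every leaf box is nonempty (`b ≤ u`) and some leaf box
is full-dimensional (`b k i < u k i` for all `i`), then for every feature `i` the lower-bound
inequality defines a face of dimension `dim Qfacet − 1`, i.e. it is facet-defining; and the
analogous statement holds for the upper-bound inequality. Dimension is the rank of the
direction submodule of the affine span. -/
theorem qfacet_facet_defining (d m : ℕ) (hd : 0 < d)
    (u b : Fin (m + 1) → Fin d → ℝ) (s : Fin (m + 1) → ℝ)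
    (hbu : ∀ l i, b l i ≤ u l i)
    (hfull : ∃ k : Fin (m + 1), ∀ i, b k i < u k i)
    (Qfacet : Set ((Fin d → ℝ) × ℝ × (Fin m → ℝ)))
    (hQ : Qfacet = {q | (∀ i, q.1 i ≤ u (Fin.last m) i +
          ∑ l : Fin m, (u l.castSucc i - u (Fin.last m) i) * q.2.2 l) ∧
        (∀ i, b (Fin.last m) i +
          ∑ l : Fin m, (b l.castSucc i - b (Fin.last m) i) * q.2.2 l ≤ q.1 i) ∧
        (q.2.1 = s (Fin.last m) + ∑ l : Fin m, q.2.2 l * (s l.castSucc - s (Fin.last m))) ∧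
        (∀ l, 0 ≤ q.2.2 l ∧ q.2.2 l ≤ 1)}) :
    ∀ i : Fin d,
      (Module.finrank ℝ (affineSpan ℝ {q ∈ Qfacet | b (Fin.last m) i +
          ∑ l : Fin m, (b l.castSucc i - b (Fin.last m) i) * q.2.2 l = q.1 i}).direction =
        Module.finrank ℝ (affineSpan ℝ Qfacet).direction - 1) ∧
      (Module.finrank ℝ (affineSpan ℝ {q ∈ Qfacet | u (Fin.last m) i +
          ∑ l : Fin m, (u l.castSucc i - u (Fin.last m) i) * q.2.2 l = q.1 i}).direction =
        Module.finrank ℝ (affineSpan ℝ Qfacet).direction - 1) := by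
  have hQ' : Qfacet = leafPolyhedron u b s := by
    rw [hQ]
    simp only [leafPolyhedron, leafSlope_apply, mul_comm]
  intro i
  have face (c : Fin (m + 1) → ℝ) : {q ∈ leafPolyhedron u b s | c (Fin.last m) +
      ∑ l : Fin m, (c l.castSucc - c (Fin.last m)) * q.2.2 l = q.1 i} =
      {q ∈ leafPolyhedron u b s | c (Fin.last m) + leafSlope c q.2.2 = q.1 i} := by
    simp only [leafSlope_apply]
  rw [hQ', face (b · i), face (u · i)]
  exact ⟨finrank_face_leafPolyhedron s hbu hfull i (c := (b · i)) (.inl rfl),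
    finrank_face_leafPolyhedron s hbu hfull i (c := (u · i)) (.inr rfl)⟩
end

section
/- (i) Q^expset ⊆ Q^misic. (ii) The mixed-integer feasible sets coincide: a pair (x, z) with x_{i,j} ∈ {0,1} for all i ∈ {1,…,d} and j ∈ {1,…,K_i} belongs to Q^expset if and only if it belongs to Q^misic. -/
open Finset

/-- The Mišić-style polyhedron over split variables `x : (i : Fin d) → Fin (K i) → ℝ` and leaf
variables `z : Fin p → ℝ`, parameterized by the families of leaf sets used in the first two
constraint families (`left`/`right` for `Qmisic`, `below`/`above` for `Qexpset`). -/
def treePoly (p d : ℕ) (K : Fin d → ℕ)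
    (L R : (i : Fin d) → Fin (K i) → Finset (Fin p)) :
    Set (((i : Fin d) → Fin (K i) → ℝ) × (Fin p → ℝ)) :=
  {q | (∀ i j, ∑ l ∈ L i j, q.2 l ≤ q.1 i j) ∧
       (∀ i j, ∑ l ∈ R i j, q.2 l ≤ 1 - q.1 i j) ∧
       (∀ (i : Fin d) (j j' : Fin (K i)), (j : ℕ) + 1 = (j' : ℕ) → q.1 i j ≤ q.1 i j') ∧
       (∑ l, q.2 l = 1) ∧
       (∀ i j, 0 ≤ q.1 i j ∧ q.1 i j ≤ 1) ∧
       (∀ l, 0 ≤ q.2 l)}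

/-- `below i j = ⋃_{k ≤ j} left i k`. -/
def belowSet (p d : ℕ) (K : Fin d → ℕ) (left : (i : Fin d) → Fin (K i) → Finset (Fin p))
    (i : Fin d) (j : Fin (K i)) : Finset (Fin p) :=
  (univ.filter (fun k => k ≤ j)).biUnion (left i)

/-- `above i j = ⋃_{k ≥ j} right i k`. -/
def aboveSet (p d : ℕ) (K : Fin d → ℕ) (right : (i : Fin d) → Fin (K i) → Finset (Fin p))
    (i : Fin d) (j : Fin (K i)) : Finset (Fin p) :=
  (univ.filter (fun k => j ≤ k)).biUnion (right i)

/-- A real function on `Fin n` that does not decrease from one index to the next is monotone. -/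
lemma monotone_of_le_of_val_add_one_eq {n : ℕ} {f : Fin n → ℝ}
    (hf : ∀ j j' : Fin n, (j : ℕ) + 1 = (j' : ℕ) → f j ≤ f j') : Monotone f := by
  cases n with
  | zero => exact fun j => j.elim0
  | succ n => exact Fin.monotone_iff_le_succ.2 fun j => hf _ _ (by simp)

/-- If a nonnegative function has nonpositive sum over each member of a family of finsets, then it
has nonpositive sum over their union. -/
lemma sum_biUnion_nonpos {ι α : Type*} [DecidableEq α] {s : Finset ι} {t : ι → Finset α}
    {z : α → ℝ} (hz : ∀ l, 0 ≤ z l) (h : ∀ k ∈ s, ∑ l ∈ t k, z l ≤ 0) :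
    ∑ l ∈ s.biUnion t, z l ≤ 0 := by
  refine Finset.sum_nonpos fun l hl => ?_
  obtain ⟨k, hk, hlk⟩ := Finset.mem_biUnion.1 hl
  exact (Finset.single_le_sum (fun m _ => hz m) hlk).trans (h k hk)

lemma subset_belowSet {p d : ℕ} {K : Fin d → ℕ}
    (left : (i : Fin d) → Fin (K i) → Finset (Fin p)) (i : Fin d) (j : Fin (K i)) :
    left i j ⊆ belowSet p d K left i j :=
  Finset.subset_biUnion_of_mem (left i) (by simp)

lemma subset_aboveSet {p d : ℕ} {K : Fin d → ℕ}
    (right : (i : Fin d) → Fin (K i) → Finset (Fin p)) (i : Fin d) (j : Fin (K i)) :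
    right i j ⊆ aboveSet p d K right i j :=
  Finset.subset_biUnion_of_mem (right i) (by simp)

/-- Enlarging the leaf sets shrinks the polyhedron. -/
lemma treePoly_anti {p d : ℕ} {K : Fin d → ℕ}
    {L L' R R' : (i : Fin d) → Fin (K i) → Finset (Fin p)}
    (hL : ∀ i j, L i j ⊆ L' i j) (hR : ∀ i j, R i j ⊆ R' i j) :
    treePoly p d K L' R' ⊆ treePoly p d K L R := by
  rintro q ⟨hl, hr, hmono, hsum, hx, hz⟩
  exact ⟨fun i j => (Finset.sum_le_sum_of_subset_of_nonneg (hL i j) fun l _ _ => hz l).trans (hl i j),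
    fun i j => (Finset.sum_le_sum_of_subset_of_nonneg (hR i j) fun l _ _ => hz l).trans (hr i j),
    hmono, hsum, hx, hz⟩

/-- At binary split variables the constraints for `left` and `right` imply those for
`belowSet` and `aboveSet`. -/
lemma mem_treePoly_belowSet_aboveSet {p d : ℕ} {K : Fin d → ℕ}
    {left right : (i : Fin d) → Fin (K i) → Finset (Fin p)}
    {q : ((i : Fin d) → Fin (K i) → ℝ) × (Fin p → ℝ)}
    (hbin : ∀ i j, q.1 i j = 0 ∨ q.1 i j = 1) (hq : q ∈ treePoly p d K left right) :
    q ∈ treePoly p d K (belowSet p d K left) (aboveSet p d K right) := by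
  obtain ⟨hl, hr, hmono, hsum, hx, hz⟩ := hq
  have hM (i) : Monotone (q.1 i) := monotone_of_le_of_val_add_one_eq (hmono i)
  have hle (s : Finset (Fin p)) : ∑ l ∈ s, q.2 l ≤ 1 :=
    hsum ▸ Finset.sum_le_univ_sum_of_nonneg hz
  refine ⟨fun i j => ?_, fun i j => ?_, hmono, hsum, hx, hz⟩
  · rcases hbin i j with h | h
    · rw [h]
      refine sum_biUnion_nonpos hz fun k hk => (hl i k).trans ?_
      exact (hM i (Finset.mem_filter.1 hk).2).trans h.le
    · rw [h]
      exact hle _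
  · rcases hbin i j with h | h
    · rw [h, sub_zero]
      exact hle _
    · rw [h, sub_self]
      refine sum_biUnion_nonpos hz fun k hk => (hr i k).trans ?_
      exact sub_nonpos.2 (h.ge.trans (hM i (Finset.mem_filter.1 hk).2))

/-- (i) `Qexpset ⊆ Qmisic`; (ii) for binary `x`, `(x, z) ∈ Qexpset ↔ (x, z) ∈
Qmisic`, i.e. the mixed-integer feasible sets coincide. -/
theorem expset_tightens_misic (p d : ℕ) (hp : 0 < p) (hd : 0 < d)
    (K : Fin d → ℕ) (hK : ∀ i, 1 ≤ K i)
    (left right : (i : Fin d) → Fin (K i) → Finset (Fin p)) :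
    treePoly p d K (belowSet p d K left) (aboveSet p d K right) ⊆ treePoly p d K left right ∧
    ∀ q : ((i : Fin d) → Fin (K i) → ℝ) × (Fin p → ℝ),
      (∀ i j, q.1 i j = 0 ∨ q.1 i j = 1) →
      (q ∈ treePoly p d K (belowSet p d K left) (aboveSet p d K right) ↔
        q ∈ treePoly p d K left right) := by
  have hsub := treePoly_anti (subset_belowSet left) (subset_aboveSet right)
  exact ⟨hsub, fun q hbin => ⟨fun hq => hsub hq, mem_treePoly_belowSet_aboveSet hbin⟩⟩
end

section
/- Assume left(s) ⊆ below(s), left(s') ⊆ below(s'), right(s) ⊆ above(s), right(s') ⊆ above(s'), together with the relations that hold when s is a left child of s' in the tree: right(s) ∪ right(s') ⊆ above(s), left(s) ⊆ left(s'), right(s) ⊆ left(s'), left(s) ∩ right(s) = ∅, left(s') ∩ right(s') = ∅, and right(s) and right(s') are nonempty. Then Q̃^expset(s,s') is a strict subset of Q̃^misic(s,s'). -/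
open Finset

/-- The reduced polyhedron on `(x_s, x_{s'}, z)` defined by the two pairs of leaf-set
constraints for splits `s` and `s'` (plus `z ≥ 0` and `x_s ≤ x_{s'}`). Instantiating the four
sets with `left(s), right(s), left(s'), right(s')` gives `Q̃^misic(s,s')`; instantiating with
`below(s), above(s), below(s'), above(s')` gives `Q̃^expset(s,s')`. -/
def reducedPoly (p : ℕ) (S1 S2 S3 S4 : Finset (Fin p)) : Set (ℝ × ℝ × (Fin p → ℝ)) :=
  {q | (∀ l, 0 ≤ q.2.2 l) ∧
       (∑ l ∈ S1, q.2.2 l ≤ q.1) ∧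
       (∑ l ∈ S2, q.2.2 l ≤ 1 - q.1) ∧
       (∑ l ∈ S3, q.2.2 l ≤ q.2.1) ∧
       (∑ l ∈ S4, q.2.2 l ≤ 1 - q.2.1) ∧
       q.1 ≤ q.2.1}

/-- under the relations that hold when split `s` is a left child of split `s'`
(on the same feature, with `s'` having the larger threshold), the reduced expset polyhedron is
a strict subset of the reduced Mišić polyhedron. -/
theorem expset_strict_subset_misic_left_child (p : ℕ) (hp : 0 < p)
    (Ls Rs Ls' Rs' Bs As Bs' As' : Finset (Fin p))
    (hLB : Ls ⊆ Bs) (hLB' : Ls' ⊆ Bs') (hRA : Rs ⊆ As) (hRA' : Rs' ⊆ As')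
    (hRRA : Rs ∪ Rs' ⊆ As)
    (hLL : Ls ⊆ Ls') (hRL : Rs ⊆ Ls')
    (hLRdisj : Ls ∩ Rs = ∅) (hLRdisj' : Ls' ∩ Rs' = ∅)
    (hRne : Rs.Nonempty) (hRne' : Rs'.Nonempty) :
    reducedPoly p Bs As Bs' As' ⊂ reducedPoly p Ls Rs Ls' Rs' := by
  have mono := fun {z : Fin p → ℝ} (hz : ∀ l, 0 ≤ z l) {S T : Finset (Fin p)} (h : S ⊆ T) =>
    Finset.sum_le_sum_of_subset_of_nonneg h (fun l _ _ => hz l)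
  refine Set.ssubset_iff_subset_ne.2 ⟨?_, fun heq => ?_⟩
  · rintro ⟨x, x', z⟩ ⟨hz, h1, h2, h3, h4, hx⟩
    exact ⟨hz, (mono hz hLB).trans h1, (mono hz hRA).trans h2, (mono hz hLB').trans h3,
      (mono hz hRA').trans h4, hx⟩
  -- The point with half a unit on a leaf of `Rs` and on a leaf of `Rs'` separates the two sets.
  · obtain ⟨a, ha⟩ := hRne
    obtain ⟨b, hb⟩ := hRne'
    have hdisj := Finset.disjoint_iff_inter_eq_empty.2 hLRdisj
    have hdisj' := Finset.disjoint_iff_inter_eq_empty.2 hLRdisj'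
    have haLs : a ∉ Ls := fun h => Finset.disjoint_left.1 hdisj h ha
    have hbLs' : b ∉ Ls' := fun h => Finset.disjoint_left.1 hdisj' h hb
    have haRs' : a ∉ Rs' := Finset.disjoint_left.1 hdisj' (hRL ha)
    have haAs : a ∈ As := hRA ha
    have hbAs : b ∈ As := hRRA (Finset.mem_union_right _ hb)
    have hsum (S : Finset (Fin p)) :
        ∑ l ∈ S, ((if l = a then (1 / 2 : ℝ) else 0) + if l = b then 1 / 2 else 0) =
          (if a ∈ S then 1 / 2 else 0) + if b ∈ S then 1 / 2 else 0 := by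
      rw [Finset.sum_add_distrib, Finset.sum_ite_eq', Finset.sum_ite_eq']
    have hmem : ((1 / 2, 1 / 2, fun l => (if l = a then 1 / 2 else 0) + if l = b then 1 / 2 else 0) :
        ℝ × ℝ × (Fin p → ℝ)) ∈ reducedPoly p Ls Rs Ls' Rs' := by
      refine ⟨fun l => by positivity, ?_, ?_, ?_, ?_, le_rfl⟩ <;> simp only [hsum]
      · rw [if_neg haLs, if_neg fun h => hbLs' (hLL h)]; norm_num
      · rw [if_pos ha, if_neg fun h => hbLs' (hRL h)]; norm_num
      · rw [if_pos (hRL ha), if_neg hbLs']; norm_num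
      · rw [if_neg haRs', if_pos hb]; norm_num
    rw [← heq] at hmem
    have h := hmem.2.2.1
    simp only [hsum, if_pos haAs, if_pos hbAs] at h
    norm_num at h
end

section
/- Assume left(s) ⊆ below(s), left(s') ⊆ below(s'), right(s) ⊆ above(s), right(s') ⊆ above(s'), together with the relations left(s) ∪ left(s') ⊆ below(s'), left(s) ∩ left(s') = ∅, left(s) ∩ (right(s) ∪ right(s')) = ∅, left(s') ∩ right(s') = ∅, and left(s) and left(s') are nonempty (these relations hold both when s' is a right child of s in the tree and when s and s' lie in different branches of the tree). Then Q̃^expset(s,s') is a strict subset of Q̃^misic(s,s'). -/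
open Finset

/-- under the relations that hold when split `s'` is a right child of split `s`,
or when `s` and `s'` lie in different branches of the tree (splits on the same feature, with
`s'` having the larger threshold), the reduced expset polyhedron is a strict subset of the
reduced Mišić polyhedron. -/
theorem expset_strict_subset_misic_right_child_or_diff_branch (p : ℕ) (hp : 0 < p)
    (Ls Rs Ls' Rs' Bs As Bs' As' : Finset (Fin p))
    (hLB : Ls ⊆ Bs) (hLB' : Ls' ⊆ Bs') (hRA : Rs ⊆ As) (hRA' : Rs' ⊆ As')
    (hLLB : Ls ∪ Ls' ⊆ Bs')
    (hLLdisj : Ls ∩ Ls' = ∅)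
    (hLRRdisj : Ls ∩ (Rs ∪ Rs') = ∅)
    (hLRdisj' : Ls' ∩ Rs' = ∅)
    (hLne : Ls.Nonempty) (hLne' : Ls'.Nonempty) :
    reducedPoly p Bs As Bs' As' ⊂ reducedPoly p Ls Rs Ls' Rs' := by
  constructor
  · rintro ⟨x, x', z⟩ ⟨hz, hB, hA, hB', hA', hx⟩
    have mono {S T : Finset (Fin p)} (h : S ⊆ T) : ∑ l ∈ S, z l ≤ ∑ l ∈ T, z l :=
      Finset.sum_le_sum_of_subset_of_nonneg h fun l _ _ => hz l
    exact ⟨hz, (mono hLB).trans hB, (mono hRA).trans hA, (mono hLB').trans hB',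
      (mono hRA').trans hA', hx⟩
  · -- Put mass `1/2` on one leaf of `left(s)` and one of `left(s')`, with `x_s = x_{s'} = 1/2`.
    obtain ⟨a, ha⟩ := hLne
    obtain ⟨b, hb⟩ := hLne'
    have haB : a ∈ Bs' := hLLB (Finset.mem_union_left _ ha)
    have hbB : b ∈ Bs' := hLB' hb
    have haL' : a ∉ Ls' := fun h => by simpa [hLLdisj] using Finset.mem_inter.2 ⟨ha, h⟩
    have hbL : b ∉ Ls := fun h => by simpa [hLLdisj] using Finset.mem_inter.2 ⟨h, hb⟩
    have haR : a ∉ Rs ∪ Rs' := fun h => by simpa [hLRRdisj] using Finset.mem_inter.2 ⟨ha, h⟩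
    have hbR' : b ∉ Rs' := fun h => by simpa [hLRdisj'] using Finset.mem_inter.2 ⟨hb, h⟩
    obtain ⟨haRs, haRs'⟩ := Finset.notMem_union.1 haR
    let z : Fin p → ℝ := fun l => (if l = a then 1 / 2 else 0) + (if l = b then 1 / 2 else 0)
    have sum_z (S : Finset (Fin p)) : ∑ l ∈ S, z l =
        (if a ∈ S then 1 / 2 else 0) + (if b ∈ S then 1 / 2 else 0) := by
      simp only [z, Finset.sum_add_distrib, Finset.sum_ite_eq']
    intro h
    have hmem : ((1 / 2, 1 / 2, z) : ℝ × ℝ × (Fin p → ℝ)) ∈ reducedPoly p Ls Rs Ls' Rs' := by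
      refine ⟨fun l => ?_, ?_, ?_, ?_, ?_, le_rfl⟩
      · dsimp only [z]
        positivity
      · simp only [sum_z, if_pos ha, if_neg hbL]
        norm_num
      · simp only [sum_z, if_neg haRs]
        split_ifs <;> norm_num
      · simp only [sum_z, if_neg haL', if_pos hb]
        norm_num
      · simp only [sum_z, if_neg haRs', if_neg hbR']
        norm_num
    obtain ⟨-, -, -, hB', -⟩ := h hmem
    simp only [sum_z, if_pos haB, if_pos hbB] at hB'
    norm_num at hB'
end

section
/- Every extreme point of the one-dimensional ensemble polyhedron Q^{1D} has all of its coordinates in {0,1}; that is, the expset formulation of a tree ensemble over a one-dimensional feature is ideal. -/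
open Finset

/-- The sum of the first `m` entries of `z`. -/
def prefixSum {n : ℕ} (z : Fin n → ℝ) (m : ℕ) : ℝ :=
  ∑ l ∈ univ.filter (fun l : Fin n => (l : ℕ) < m), z l

/-- The vector whose prefix sums are `φ` of those of `z`, provided `φ 0 = 0`. -/
def reparam (φ : ℝ → ℝ) {n : ℕ} (z : Fin n → ℝ) (l : Fin n) : ℝ :=
  φ (prefixSum z (l + 1)) - φ (prefixSum z l)

lemma prefixSum_zero {n : ℕ} (z : Fin n → ℝ) : prefixSum z 0 = 0 := by
  simp [prefixSum]

lemma prefixSum_length {n : ℕ} (z : Fin n → ℝ) : prefixSum z n = ∑ l, z l := by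
  simp [prefixSum]

lemma prefixSum_succ {n : ℕ} (z : Fin n → ℝ) (l : Fin n) :
    prefixSum z (l + 1) = prefixSum z l + z l := by
  have h : univ.filter (fun i : Fin n => (i : ℕ) < (l : ℕ) + 1) =
      insert l (univ.filter (fun i : Fin n => (i : ℕ) < (l : ℕ))) := by
    ext i
    simp only [mem_filter, mem_univ, true_and, mem_insert, Fin.ext_iff]
    omega
  rw [prefixSum, h, sum_insert (by simp), add_comm, prefixSum]

lemma sum_filter_le_eq_prefixSum {n : ℕ} (z : Fin n → ℝ) (j : ℕ) :
    ∑ l ∈ univ.filter (fun l : Fin n => (l : ℕ) ≤ j), z l = prefixSum z (j + 1) := by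
  simp only [prefixSum, Nat.lt_succ_iff]

lemma sum_filter_lt_eq_sub_prefixSum {n : ℕ} (z : Fin n → ℝ) (j : ℕ) :
    ∑ l ∈ univ.filter (fun l : Fin n => j < (l : ℕ)), z l =
      ∑ l, z l - prefixSum z (j + 1) := by
  rw [← sum_filter_le_eq_prefixSum,
    ← sum_filter_add_sum_filter_not univ (fun l : Fin n => (l : ℕ) ≤ j) z]
  simp only [not_le]
  ring

lemma prefixSum_mem_Icc {n : ℕ} {z : Fin n → ℝ} (hz : ∀ l, 0 ≤ z l) (hsum : ∑ l, z l = 1)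
    (m : ℕ) : prefixSum z m ∈ Set.Icc (0 : ℝ) 1 :=
  ⟨sum_nonneg fun l _ => hz l,
    hsum ▸ sum_le_sum_of_subset_of_nonneg (filter_subset _ _) fun l _ _ => hz l⟩

lemma prefixSum_reparam {φ : ℝ → ℝ} (hφ : φ 0 = 0) {n : ℕ} (z : Fin n → ℝ) :
    ∀ m ≤ n, prefixSum (reparam φ z) m = φ (prefixSum z m) := by
  intro m
  induction m with
  | zero => intro _; rw [prefixSum_zero, prefixSum_zero, hφ]
  | succ m ih =>
    intro hm
    have h := prefixSum_succ (reparam φ z) ⟨m, hm⟩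
    simp only [reparam] at h
    rw [h]
    change prefixSum (reparam φ z) m + _ = _
    rw [ih (by omega)]
    ring

/-- The one-dimensional ensemble polyhedron. -/
def ensemblePolyhedron {K T : ℕ} (p : Fin T → ℕ) (σ : (t : Fin T) → Fin (p t - 1) → Fin K) :
    Set ((Fin K → ℝ) × ((t : Fin T) → Fin (p t) → ℝ)) :=
  {q | (∀ (t : Fin T) (j : Fin (p t - 1)),
      (∑ l ∈ univ.filter (fun l : Fin (p t) => (l : ℕ) ≤ (j : ℕ)), q.2 t l ≤ q.1 (σ t j)) ∧
      (∑ l ∈ univ.filter (fun l : Fin (p t) => (j : ℕ) < (l : ℕ)), q.2 t l ≤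
        1 - q.1 (σ t j))) ∧
    (∀ t, ∑ l, q.2 t l = 1) ∧
    (∀ t l, 0 ≤ q.2 t l) ∧
    (∀ k, 0 ≤ q.1 k ∧ q.1 k ≤ 1) ∧
    (∀ k k' : Fin K, (k : ℕ) + 1 = (k' : ℕ) → q.1 k ≤ q.1 k')}

/-- The split constraints of the ensemble polyhedron amount to equalities between the split
variables and the prefix sums of the leaf variables. -/
lemma mem_ensemblePolyhedron_iff {K T : ℕ} {p : Fin T → ℕ}
    {σ : (t : Fin T) → Fin (p t - 1) → Fin K}
    {q : (Fin K → ℝ) × ((t : Fin T) → Fin (p t) → ℝ)} :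
    q ∈ ensemblePolyhedron p σ ↔
      (∀ t (j : Fin (p t - 1)), prefixSum (q.2 t) (j + 1) = q.1 (σ t j)) ∧
      (∀ t, ∑ l, q.2 t l = 1) ∧ (∀ t l, 0 ≤ q.2 t l) ∧ (∀ k, 0 ≤ q.1 k ∧ q.1 k ≤ 1) ∧
      (∀ k k' : Fin K, (k : ℕ) + 1 = (k' : ℕ) → q.1 k ≤ q.1 k') := by
  simp only [ensemblePolyhedron, Set.mem_ofPred_eq, sum_filter_le_eq_prefixSum,
    sum_filter_lt_eq_sub_prefixSum]
  refine and_congr_left fun ⟨hsum, _⟩ => forall₂_congr fun t j => ?_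
  rw [hsum t]
  constructor
  · rintro ⟨h₁, h₂⟩
    linarith
  · intro h
    constructor <;> linarith

/-- Reparametrizing all coordinates by an increasing self-map of `[0, 1]` that fixes both ends
preserves the ensemble polyhedron. -/
lemma reparam_mem_ensemblePolyhedron {K T : ℕ} {p : Fin T → ℕ}
    {σ : (t : Fin T) → Fin (p t - 1) → Fin K} {φ : ℝ → ℝ} (hφ₀ : φ 0 = 0) (hφ₁ : φ 1 = 1)
    (hφ : MonotoneOn φ (Set.Icc 0 1)) {q : (Fin K → ℝ) × ((t : Fin T) → Fin (p t) → ℝ)}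
    (hq : q ∈ ensemblePolyhedron p σ) :
    ((fun k => φ (q.1 k), fun t => reparam φ (q.2 t)) :
      (Fin K → ℝ) × ((t : Fin T) → Fin (p t) → ℝ)) ∈ ensemblePolyhedron p σ := by
  rw [mem_ensemblePolyhedron_iff] at hq ⊢
  obtain ⟨hsplit, hsum, hz, hx, hmono⟩ := hq
  refine ⟨fun t j => ?_, fun t => ?_, fun t l => ?_, fun k => ⟨?_, ?_⟩, fun k k' h => ?_⟩
  · rw [prefixSum_reparam hφ₀ _ _ (by omega), hsplit]
  · rw [← prefixSum_length, prefixSum_reparam hφ₀ _ _ le_rfl, prefixSum_length, hsum, hφ₁]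
  · refine sub_nonneg.2 (hφ (prefixSum_mem_Icc (hz t) (hsum t) _)
      (prefixSum_mem_Icc (hz t) (hsum t) _) ?_)
    rw [prefixSum_succ]
    linarith [hz t l]
  · rw [← hφ₀]
    exact hφ (by simp) (hx k) (hx k).1
  · rw [← hφ₁]
    exact hφ (hx k) (by simp) (hx k).2
  · exact hφ (hx k) (hx k') (hmono k k' h)

/-- the expset formulation of a tree ensemble over one-dimensional features is
ideal: every extreme point of the one-dimensional ensemble polyhedron `Q1D` has all of its
coordinates in `{0, 1}`. Here `K` is the number of distinct thresholds, `T` the number of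
trees, `p t` the number of leaves of tree `t` (leaves and splits of each tree ordered from
left to right along the real line), and `σ t j` the global rank of the threshold of the
`j`-th split of tree `t` (so `σ t` is strictly increasing). -/
theorem one_dim_ensemble_ideal (K T : ℕ) (hK : 0 < K) (hT : 0 < T)
    (p : Fin T → ℕ) (hp : ∀ t, 1 ≤ p t)
    (σ : (t : Fin T) → Fin (p t - 1) → Fin K)
    (hσ : ∀ t, StrictMono (σ t))
    (Q1D : Set ((Fin K → ℝ) × ((t : Fin T) → Fin (p t) → ℝ)))
    (hQ : Q1D = {q | (∀ (t : Fin T) (j : Fin (p t - 1)),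
          (∑ l ∈ univ.filter (fun l : Fin (p t) => (l : ℕ) ≤ (j : ℕ)), q.2 t l ≤ q.1 (σ t j)) ∧
          (∑ l ∈ univ.filter (fun l : Fin (p t) => (j : ℕ) < (l : ℕ)), q.2 t l ≤
            1 - q.1 (σ t j))) ∧
        (∀ t, ∑ l, q.2 t l = 1) ∧
        (∀ t l, 0 ≤ q.2 t l) ∧
        (∀ k, 0 ≤ q.1 k ∧ q.1 k ≤ 1) ∧
        (∀ k k' : Fin K, (k : ℕ) + 1 = (k' : ℕ) → q.1 k ≤ q.1 k')})
    (v : (Fin K → ℝ) × ((t : Fin T) → Fin (p t) → ℝ)) (hv : v ∈ Q1D)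
    (hext : ∀ a ∈ Q1D, ∀ b ∈ Q1D, ∀ θ : ℝ, 0 < θ → θ < 1 →
      v = θ • a + (1 - θ) • b → a = v ∧ b = v) :
    (∀ k, v.1 k = 0 ∨ v.1 k = 1) ∧ (∀ t l, v.2 t l = 0 ∨ v.2 t l = 1) := by
  change Q1D = ensemblePolyhedron p σ at hQ
  subst hQ
  have hsq : MonotoneOn (fun s : ℝ => s ^ 2) (Set.Icc 0 1) := by
    intro a ha b _ hab
    exact pow_le_pow_left₀ ha.1 hab 2
  have hsq' : MonotoneOn (fun s : ℝ => 2 * s - s ^ 2) (Set.Icc 0 1) := by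
    intro a ha b hb hab
    dsimp only
    nlinarith [mul_nonneg (sub_nonneg.2 hab) (show 0 ≤ 2 - a - b by linarith [ha.2, hb.2])]
  obtain ⟨hfix, -⟩ := hext _ (reparam_mem_ensemblePolyhedron (by norm_num) (by norm_num) hsq hv)
    _ (reparam_mem_ensemblePolyhedron (by norm_num) (by norm_num) hsq' hv) (1 / 2)
    (by norm_num) (by norm_num) (by
      refine Prod.ext (funext fun k => ?_) (funext fun t => funext fun l => ?_)
      · simp only [Prod.fst_add, Prod.smul_fst, Pi.add_apply, Pi.smul_apply, smul_eq_mul]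
        ring
      · simp only [Prod.snd_add, Prod.smul_snd, Pi.add_apply, Pi.smul_apply, smul_eq_mul, reparam,
          prefixSum_succ]
        ring)
  have zero_or_one : ∀ s : ℝ, s ^ 2 = s → s = 0 ∨ s = 1 := fun s hs =>
    (mul_eq_zero.1 (show s * (s - 1) = 0 by linarith)).imp_right sub_eq_zero.1
  refine ⟨fun k => zero_or_one _ (congrFun (congrArg Prod.fst hfix) k), fun t l => ?_⟩
  have hz := congrFun (congrArg Prod.snd hfix) t
  have hprefix : ∀ m ≤ p t, prefixSum (v.2 t) m = 0 ∨ prefixSum (v.2 t) m = 1 := by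
    intro m hm
    have h := prefixSum_reparam (φ := fun s : ℝ => s ^ 2) (by norm_num) (v.2 t) m hm
    exact zero_or_one _ (h.symm.trans (congrArg (prefixSum · m) hz))
  have hnonneg := (mem_ensemblePolyhedron_iff.1 hv).2.2.1 t l
  have hsucc := prefixSum_succ (v.2 t) l
  rcases hprefix l l.2.le with h₀ | h₀ <;> rcases hprefix (l + 1) l.2 with h₁ | h₁ <;>
    rw [h₀, h₁] at hsucc
  · left; linarith
  · right; linarith
  · linarith
  · left; linarith
end

section
/- The matrix A defined as follows is totally unimodular (every square submatrix has determinant −1, 0, or 1). The rows of A are indexed by pairs (t, j) with t ∈ {1,…,T}, j ∈ {1,…,p_t−1}, and by integers k ∈ {1,…,K−1}; the columns are indexed by pairs (t, l) with t ∈ {1,…,T}, l ∈ {1,…,p_t}, and by integers k ∈ {1,…,K}. The entries are: A[(t,j), (t',l)] = 1 if t' = t and l ≤ j, and 0 otherwise; A[(t,j), k] = −1 if k = σ_t(j), and 0 otherwise; A[k, (t,l)] = 0 for all leaf columns; A[k, k'] = −1 if k' = k, A[k, k'] = 1 if k' = k+1, and 0 otherwise. -/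
open Matrix in
/-- A square matrix whose rows are differences of two (possibly absent) unit vectors has
determinant `-1`, `0` or `1`. -/
lemma det_incidence_mem_range_signType_cast {α : Type*} [DecidableEq α] (k : ℕ)
    (a b g : Fin k → α) (hg : g.Injective) :
    (of fun i j : Fin k =>
      (if a i = g j then (1 : ℝ) else 0) - (if b i = g j then 1 else 0)).det ∈
        Set.range SignType.cast := by
  induction k with
  | zero => exact ⟨1, by simp⟩
  | succ k ih =>
    by_cases h : ∀ i, (∃ j, a i = g j) ∧ ∃ j, b i = g j
    · refine ⟨0, ?_⟩
      rw [SignType.coe_zero, eq_comm, ← exists_mulVec_eq_zero_iff]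
      refine ⟨1, one_ne_zero, funext fun i => ?_⟩
      obtain ⟨⟨j₁, h₁⟩, j₂, h₂⟩ := h i
      simp [mulVec, dotProduct, h₁, h₂, hg.eq_iff]
    · push Not at h
      obtain ⟨i, hi⟩ := h
      obtain ⟨j₀, s, hs⟩ : ∃ (j₀ : Fin (k + 1)) (s : SignType), ∀ j,
          (if a i = g j then (1 : ℝ) else 0) - (if b i = g j then 1 else 0) =
            if j = j₀ then (s : ℝ) else 0 := by
        by_cases ha : ∃ j, a i = g j
        · obtain ⟨j₀, hj₀⟩ := ha
          have hb := hi ⟨j₀, hj₀⟩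
          exact ⟨j₀, 1, fun j => by simp [hj₀, hb j, hg.eq_iff, eq_comm]⟩
        · push Not at ha
          by_cases hb : ∃ j, b i = g j
          · obtain ⟨j₀, hj₀⟩ := hb
            refine ⟨j₀, -1, fun j => ?_⟩
            rcases eq_or_ne j j₀ with rfl | hj
            · simp [ha, hj₀]
            · simp [ha, hj₀, hg.eq_iff, hj, hj.symm]
          · push Not at hb
            exact ⟨0, 0, fun j => by simp [ha j, hb j]⟩
      obtain ⟨r, hr⟩ := ih (a ∘ i.succAbove) (b ∘ i.succAbove) (g ∘ j₀.succAbove)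
        (hg.comp Fin.succAbove_right_injective)
      refine ⟨(-1) ^ (i + j₀ : ℕ) * s * r, ?_⟩
      rw [det_succ_row _ i, Finset.sum_eq_single j₀]
      · simp only [of_apply, hs, if_true, SignType.coe_mul, SignType.coe_pow, SignType.coe_neg,
          SignType.coe_one, hr]
        rfl
      · intro j _ hj
        simp [hs, hj]
      · simp

open Matrix in
/-- If every square matrix made of full rows of `A` and unit rows has determinant `-1`, `0` or
`1`, then `A` is totally unimodular. -/
lemma isTotallyUnimodular_of_fromRows_one {m n : Type*} [Fintype n] [DecidableEq n]
    {A : Matrix m n ℝ}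
    (h : ∀ S : n → m ⊕ n, ((fromRows A 1).submatrix S id).det ∈ Set.range SignType.cast) :
    A.IsTotallyUnimodular := by
  classical
  intro k f g _ hg
  let e : Fin k ⊕ ((Set.range g)ᶜ : Set n) ≃ n :=
    ((Equiv.ofInjective g hg).sumCongr (Equiv.refl _)).trans (Equiv.Set.sumCompl (Set.range g))
  have hl : ∀ i, e (Sum.inl i) = g i := fun i => by simp [e]
  have hr : ∀ c, e (Sum.inr c) = c := fun c => by simp [e]
  let R : Fin k ⊕ ((Set.range g)ᶜ : Set n) → m ⊕ n := Sum.map f Subtype.val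
  have hS := h (R ∘ e.symm)
  rw [← det_submatrix_equiv_self e] at hS
  have hB : ((fromRows A 1).submatrix (R ∘ e.symm) id).submatrix e e =
      fromBlocks (A.submatrix f g) (A.submatrix f Subtype.val) 0 1 := by
    have hR : ((fromRows A 1).submatrix (R ∘ e.symm) id).submatrix e e =
        (fromRows A 1).submatrix R e := by
      ext i j
      simp
    rw [hR]
    ext i j
    rcases i with i | i <;> rcases j with j | j
    · simp [R, hl]
    · simp [R, hr]
    · have : (i : n) ≠ g j := fun hij => i.2 ⟨j, hij.symm⟩
      simp [R, hl, this]
    · simp [R, hr, one_apply, Subtype.ext_iff]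
  rwa [hB, det_fromBlocks_zero₂₁, det_one, mul_one] at hS

open Matrix in
/-- Network matrices are totally unimodular: `V` is the set of non-root nodes of a rooted forest
with parent map `parent` (`none` being the root), `P v` is the indicator of the path from the root
to `v`, and the `i`-th row of `A` is the signed path from `tail i` to `head i`. -/
lemma isTotallyUnimodular_of_network {m V : Type*} [Fintype V] [DecidableEq V]
    (A : Matrix m V ℝ) (P : Matrix V V ℝ) (parent : V → Option V) (head tail : m → Option V)
    (hP : ∀ v w, P v w - (parent v).elim 0 (fun u => P u w) = if v = w then 1 else 0)
    (hA : ∀ i w, A i w = (head i).elim 0 (fun u => P u w) - (tail i).elim 0 (fun u => P u w)) :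
    A.IsTotallyUnimodular := by
  let a : m ⊕ V → Option V := Sum.elim head some
  let b : m ⊕ V → Option V := Sum.elim tail parent
  let E : Matrix (m ⊕ V) V ℝ := of fun r v =>
    (if a r = some v then 1 else 0) - (if b r = some v then 1 else 0)
  have hE : ∀ S : V → m ⊕ V, (E.submatrix S id).det ∈ Set.range SignType.cast := by
    intro S
    let e := (Fintype.equivFin V).symm
    rw [← det_submatrix_equiv_self e]
    exact det_incidence_mem_range_signType_cast _ (fun i => a (S (e i))) (fun i => b (S (e i)))
      (fun j => some (e j)) ((Option.some_injective V).comp e.injective)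
  have hsum : ∀ (o : Option V) (w : V),
      ∑ v, (if o = some v then (1 : ℝ) else 0) * P v w = o.elim 0 (fun u => P u w) := by
    intro o w
    cases o <;> simp
  have hEP : E * P = fromRows A 1 := by
    ext r w
    rw [mul_apply]
    simp only [E, of_apply, sub_mul, Finset.sum_sub_distrib, hsum]
    rcases r with i | v
    · simp [a, b, hA]
    · simpa [a, b, one_apply] using hP v w
  have hdetP : P.det ∈ Set.range (SignType.cast : SignType → ℝ) := by
    obtain ⟨s, hs⟩ := hE Sum.inr
    have hQ : E.submatrix Sum.inr id * P = 1 := by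
      ext v w
      exact congrFun (congrFun hEP (Sum.inr v)) w
    have hd := congrArg det hQ
    rw [det_mul, det_one, ← hs] at hd
    refine ⟨s, ?_⟩
    rcases s with _ | _ | _ <;> simp at hd ⊢ <;> linarith
  refine isTotallyUnimodular_of_fromRows_one fun S => ?_
  have hS : (fromRows A 1).submatrix S id = E.submatrix S id * P := by
    rw [← hEP]
    rfl
  obtain ⟨s, hs⟩ := hE S
  obtain ⟨r, hr⟩ := hdetP
  exact ⟨s * r, by rw [hS, det_mul, ← hs, ← hr, SignType.coe_mul]⟩

/-- the constraint matrix of the one-dimensional ensemble expset formulation is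
totally unimodular. Rows are indexed by split pairs `(t, j)` and by `k ∈ {1,…,K−1}`; columns
by leaf pairs `(t, l)` and by `k ∈ {1,…,K}`. Entries: `A[(t,j),(t',l)] = 1` iff `t' = t` and
`l ≤ j`; `A[(t,j), k] = −1` iff `k = σ t j`; `A[k, (t,l)] = 0`; `A[k, k'] = −1` if `k' = k`,
`1` if `k' = k + 1`, and `0` otherwise. -/
theorem one_dim_matrix_totally_unimodular (K T : ℕ) (hK : 0 < K) (hT : 0 < T)
    (p : Fin T → ℕ) (hp : ∀ t, 1 ≤ p t)
    (σ : (t : Fin T) → Fin (p t - 1) → Fin K)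
    (hσ : ∀ t, StrictMono (σ t)) :
    (Matrix.of fun (r : (Σ t : Fin T, Fin (p t - 1)) ⊕ Fin (K - 1))
        (c : (Σ t : Fin T, Fin (p t)) ⊕ Fin K) =>
      match r, c with
      | Sum.inl ⟨t, j⟩, Sum.inl ⟨t', l⟩ =>
          if t' = t ∧ (l : ℕ) ≤ (j : ℕ) then (1 : ℝ) else 0
      | Sum.inl ⟨t, j⟩, Sum.inr k => if k = σ t j then -1 else 0
      | Sum.inr _, Sum.inl _ => 0
      | Sum.inr k, Sum.inr k' =>
          if (k' : ℕ) = (k : ℕ) then -1 else if (k' : ℕ) = (k : ℕ) + 1 then 1 else 0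
      ).IsTotallyUnimodular := by
  let V := (Σ t : Fin T, Fin (p t)) ⊕ Fin K
  let P : Matrix V V ℝ := Matrix.of fun v w =>
    match v, w with
    | Sum.inl ⟨t, j⟩, Sum.inl ⟨t', l⟩ => if t' = t ∧ (l : ℕ) ≤ (j : ℕ) then 1 else 0
    | Sum.inr k, Sum.inr k' => if k' = k then 1 else 0
    | _, _ => 0
  let parent : V → Option V
    | Sum.inl ⟨t, j⟩ =>
      if (j : ℕ) = 0 then none else some (Sum.inl ⟨t, ⟨(j : ℕ) - 1, by omega⟩⟩)
    | Sum.inr _ => none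
  let head : (Σ t : Fin T, Fin (p t - 1)) ⊕ Fin (K - 1) → Option V
    | Sum.inl ⟨t, j⟩ => some (Sum.inl ⟨t, ⟨j, by omega⟩⟩)
    | Sum.inr k => some (Sum.inr ⟨(k : ℕ) + 1, by omega⟩)
  let tail : (Σ t : Fin T, Fin (p t - 1)) ⊕ Fin (K - 1) → Option V
    | Sum.inl ⟨t, j⟩ => some (Sum.inr (σ t j))
    | Sum.inr k => some (Sum.inr ⟨k, by omega⟩)
  refine isTotallyUnimodular_of_network _ P parent head tail ?_ ?_
  · rintro (⟨t, j⟩ | k) (⟨t', l⟩ | k')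
    · by_cases ht : t' = t
      · subst ht
        by_cases hj : (j : ℕ) = 0
        · simp [P, parent, hj, Fin.ext_iff, eq_comm]
        · simp only [P, parent, hj, Matrix.of_apply, if_false, Option.elim_some, true_and,
            Sum.inl.injEq, Sigma.mk.injEq, heq_eq_eq, Fin.ext_iff]
          split_ifs <;> first | omega | norm_num
      · by_cases hj : (j : ℕ) = 0 <;> simp [P, parent, hj, ht, Ne.symm ht]
    · by_cases hj : (j : ℕ) = 0 <;> simp [P, parent, hj]
    · simp [P, parent]
    · simp [P, parent, eq_comm]
  · rintro (⟨t, j⟩ | k) (⟨t', l⟩ | k')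
    · simp [P, head, tail]
    · simp only [P, head, tail, Matrix.of_apply, Option.elim_some]
      split_ifs <;> norm_num
    · simp [P, head, tail]
    · simp only [P, head, tail, Matrix.of_apply, Option.elim_some, Fin.ext_iff]
      split_ifs <;> first | omega | norm_num
end

section
/- Assume right(i,j) ⊆ left(i,j') for every right-parent pair ((i,j),(i,j')) and left(i,j') ⊆ right(i,j) for every left-parent pair ((i,j),(i,j')). Then: (i) Q^elbow ⊆ Q^misic; (ii) the mixed-integer feasible sets coincide: a pair (x, z) with x_{i,j} ∈ {0,1} for all i ∈ {1,…,d} and j ∈ {1,…,K_i} belongs to Q^elbow if and only if it belongs to Q^misic. -/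
open Finset

/-- The Mišić polyhedron over split variables `x : (i : Fin d) → Fin (K i) → ℝ` and leaf
variables `z : Fin p → ℝ`. -/
def misicPoly (p d : ℕ) (K : Fin d → ℕ)
    (left right : (i : Fin d) → Fin (K i) → Finset (Fin p)) :
    Set (((i : Fin d) → Fin (K i) → ℝ) × (Fin p → ℝ)) :=
  {q | (∀ i j, ∑ l ∈ left i j, q.2 l ≤ q.1 i j) ∧
       (∀ i j, ∑ l ∈ right i j, q.2 l ≤ 1 - q.1 i j) ∧
       (∀ (i : Fin d) (j j' : Fin (K i)), (j : ℕ) + 1 = (j' : ℕ) → q.1 i j ≤ q.1 i j') ∧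
       (∑ l, q.2 l = 1) ∧
       (∀ i j, 0 ≤ q.1 i j ∧ q.1 i j ≤ 1) ∧
       (∀ l, 0 ≤ q.2 l)}

/-- The elbow polyhedron: `misicPoly` intersected with the elbow constraints for every
right-parent pair `RP i j j'` and every left-parent pair `LP i j j'`. -/
def elbowPoly (p d : ℕ) (K : Fin d → ℕ)
    (left right : (i : Fin d) → Fin (K i) → Finset (Fin p))
    (RP LP : (i : Fin d) → Fin (K i) → Fin (K i) → Prop) :
    Set (((i : Fin d) → Fin (K i) → ℝ) × (Fin p → ℝ)) :=
  misicPoly p d K left right ∩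
    {q | (∀ (i : Fin d) (j j' : Fin (K i)), RP i j j' →
            ∑ l ∈ right i j, q.2 l ≤ q.1 i j' - q.1 i j) ∧
         (∀ (i : Fin d) (j j' : Fin (K i)), LP i j j' →
            ∑ l ∈ left i j', q.2 l ≤ q.1 i j' - q.1 i j)}

/-- The order constraints on consecutive splits make `q.1 i` monotone. -/
lemma monotone_of_mem_misicPoly {p d : ℕ} {K : Fin d → ℕ}
    {left right : (i : Fin d) → Fin (K i) → Finset (Fin p)}
    {q : ((i : Fin d) → Fin (K i) → ℝ) × (Fin p → ℝ)}
    (hq : q ∈ misicPoly p d K left right) (i : Fin d) : Monotone (q.1 i) := by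
  obtain ⟨-, -, hstep, -⟩ := hq
  rintro ⟨a, ha⟩ ⟨b, hb⟩ hab
  have hab : a ≤ b := hab
  induction b, hab using Nat.le_induction with
  | base => exact le_rfl
  | succ n _ ih => exact (ih (by omega) (by assumption)).trans (hstep i ⟨n, by omega⟩ ⟨n + 1, hb⟩ rfl)

/-- For binary `a ≤ b`, the bounds `s ≤ b` and `s ≤ 1 - a` combine to `s ≤ b - a`. -/
lemma le_sub_of_binary {a b s : ℝ} (ha : a = 0 ∨ a = 1) (hb : b = 0 ∨ b = 1) (hab : a ≤ b)
    (hsb : s ≤ b) (hsa : s ≤ 1 - a) : s ≤ b - a := by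
  rcases ha with rfl | rfl <;> rcases hb with rfl | rfl <;> linarith

/-- assuming `right(i,j) ⊆ left(i,j')` for every right-parent pair `((i,j),(i,j'))`
(with `j < j'`) and `left(i,j') ⊆ right(i,j)` for every left-parent pair (with `j < j'`):
(i) `Qelbow ⊆ Qmisic`; (ii) the mixed-integer feasible sets coincide: for binary `x`,
`(x, z) ∈ Qelbow ↔ (x, z) ∈ Qmisic`. -/
theorem elbow_tightens_misic (p d : ℕ) (hp : 0 < p) (hd : 0 < d)
    (K : Fin d → ℕ) (hK : ∀ i, 1 ≤ K i)
    (left right : (i : Fin d) → Fin (K i) → Finset (Fin p))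
    (RP LP : (i : Fin d) → Fin (K i) → Fin (K i) → Prop)
    (hRPlt : ∀ i j j', RP i j j' → j < j')
    (hLPlt : ∀ i j j', LP i j j' → j < j')
    (hRPsub : ∀ i j j', RP i j j' → right i j ⊆ left i j')
    (hLPsub : ∀ i j j', LP i j j' → left i j' ⊆ right i j) :
    elbowPoly p d K left right RP LP ⊆ misicPoly p d K left right ∧
    ∀ q : ((i : Fin d) → Fin (K i) → ℝ) × (Fin p → ℝ),
      (∀ i j, q.1 i j = 0 ∨ q.1 i j = 1) →
      (q ∈ elbowPoly p d K left right RP LP ↔ q ∈ misicPoly p d K left right) := by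
  refine ⟨Set.inter_subset_left, fun q hbin => ⟨fun h => h.1, fun h => ⟨h, ?_, ?_⟩⟩⟩
  · intro i j j' hj
    have hmono := monotone_of_mem_misicPoly h i (hRPlt i j j' hj).le
    obtain ⟨hleft, hright, -, -, -, hz⟩ := h
    exact le_sub_of_binary (hbin i j) (hbin i j') hmono
      ((sum_le_sum_of_subset_of_nonneg (hRPsub i j j' hj) fun l _ _ => hz l).trans (hleft i j'))
      (hright i j)
  · intro i j j' hj
    have hmono := monotone_of_mem_misicPoly h i (hLPlt i j j' hj).le
    obtain ⟨hleft, hright, -, -, -, hz⟩ := h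
    exact le_sub_of_binary (hbin i j) (hbin i j') hmono (hleft i j')
      ((sum_le_sum_of_subset_of_nonneg (hLPsub i j j' hj) fun l _ _ => hz l).trans (hright i j))
end

section
/- The point (x_1, x_2, z_1, z_2, z_3) = (1/2, 1/2, 0, 1/2, 1/2) is an extreme point of the polyhedron P = {(x_1, x_2, z_1, z_2, z_3) ∈ ℝ^5 : z_2 ≤ 1 − x_2, z_3 ≤ 1 − x_1, z_1 ≤ x_2, z_1 + z_2 ≤ x_1, x_2 ≤ x_1, z_1 + z_2 + z_3 = 1, 0 ≤ x_1 ≤ 1, 0 ≤ x_2 ≤ 1, z_1 ≥ 0, z_2 ≥ 0, z_3 ≥ 0}. In particular P has a fractional extreme point, so this formulation of a single decision tree is not ideal. -/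
/-- A strict convex combination of nonnegative reals vanishes only if both of them do. -/
lemma eq_zero_and_eq_zero_of_convexCombination_eq_zero {t u v : ℝ} (ht : 0 < t) (ht' : t < 1)
    (hu : 0 ≤ u) (hv : 0 ≤ v) (h : t * u + (1 - t) * v = 0) : u = 0 ∧ v = 0 := by
  have hs : 0 < 1 - t := sub_pos.2 ht'
  obtain ⟨h₁, h₂⟩ := (add_eq_zero_iff_of_nonneg (by positivity) (by positivity)).1 h
  exact ⟨(mul_eq_zero.1 h₁).resolve_left ht.ne', (mul_eq_zero.1 h₂).resolve_left hs.ne'⟩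

/-- the fractional point `(x₁, x₂, z₁, z₂, z₃) = (1/2, 1/2, 0, 1/2, 1/2)` is an
extreme point of the LP relaxation `P` of the Mišić formulation of the two-split decision
tree; in particular this formulation of a single decision tree is not ideal.
Coordinates: `q = (x₁, x₂, z₁, z₂, z₃)`. -/
theorem misic_tree_not_ideal (P : Set (ℝ × ℝ × ℝ × ℝ × ℝ))
    (hP : P = {q | q.2.2.2.1 ≤ 1 - q.2.1 ∧
        q.2.2.2.2 ≤ 1 - q.1 ∧
        q.2.2.1 ≤ q.2.1 ∧
        q.2.2.1 + q.2.2.2.1 ≤ q.1 ∧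
        q.2.1 ≤ q.1 ∧
        q.2.2.1 + q.2.2.2.1 + q.2.2.2.2 = 1 ∧
        0 ≤ q.1 ∧ q.1 ≤ 1 ∧ 0 ≤ q.2.1 ∧ q.2.1 ≤ 1 ∧
        0 ≤ q.2.2.1 ∧ 0 ≤ q.2.2.2.1 ∧ 0 ≤ q.2.2.2.2}) :
    ((1/2, 1/2, 0, 1/2, 1/2) : ℝ × ℝ × ℝ × ℝ × ℝ) ∈ P ∧
    ∀ a ∈ P, ∀ b ∈ P, ∀ t : ℝ, 0 < t → t < 1 →
      ((1/2, 1/2, 0, 1/2, 1/2) : ℝ × ℝ × ℝ × ℝ × ℝ) = t • a + (1 - t) • b →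
      a = ((1/2, 1/2, 0, 1/2, 1/2) : ℝ × ℝ × ℝ × ℝ × ℝ) ∧
      b = ((1/2, 1/2, 0, 1/2, 1/2) : ℝ × ℝ × ℝ × ℝ × ℝ) := by
  subst hP
  refine ⟨by norm_num, ?_⟩
  rintro ⟨x₁, x₂, z₁, z₂, z₃⟩ ⟨ha₁, ha₂, -, ha₃, ha₄, ha₅, -, -, -, -, ha₆, -, -⟩
    ⟨y₁, y₂, w₁, w₂, w₃⟩ ⟨hb₁, hb₂, -, hb₃, hb₄, hb₅, -, -, -, -, hb₆, -, -⟩ t ht ht' h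
  simp only [Prod.smul_mk, Prod.mk_add_mk, Prod.mk.injEq, smul_eq_mul] at *
  obtain ⟨h₁, h₂, h₃, h₄, -⟩ := h
  -- The constraints `0 ≤ z₁`, `x₂ ≤ x₁` and `z₂ ≤ 1 - x₂` are tight at the fractional point,
  -- hence at both endpoints; `x₁ = z₁ + z₂` holds on all of `P`.
  obtain ⟨hz, hw⟩ :=
    eq_zero_and_eq_zero_of_convexCombination_eq_zero ht ht' ha₆ hb₆ h₃.symm
  obtain ⟨hx, hy⟩ := eq_zero_and_eq_zero_of_convexCombination_eq_zero ht ht'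
    (sub_nonneg.2 ha₄) (sub_nonneg.2 hb₄) (by linarith)
  obtain ⟨hxz, hyw⟩ := eq_zero_and_eq_zero_of_convexCombination_eq_zero ht ht'
    (sub_nonneg.2 ha₁) (sub_nonneg.2 hb₁) (by linarith)
  refine ⟨⟨?_, ?_, ?_, ?_, ?_⟩, ?_, ?_, ?_, ?_, ?_⟩ <;> linarith
end

section
/- The point (w, x_{11}, x_{12}, x_{21}, x_{22}) = (0, 1/3, 2/3, 1/3, 0) is an extreme point of the polyhedron P = {(w, x_{11}, x_{12}, x_{21}, x_{22}) ∈ ℝ^5 : w − 15(1 − x_{11}) ≤ 5, w − 15(1 − x_{21}) ≤ 2, w + 15(1 − x_{12}) ≥ 5, w + 15(1 − x_{22}) ≥ 2, x_{21} + x_{22} = x_{11}, x_{12} + x_{21} + x_{22} = 1, 0 ≤ x_{11}, x_{12}, x_{21}, x_{22} ≤ 1, 0 ≤ w ≤ 10}. In particular P has a fractional extreme point, so this big-M formulation of a single decision tree is not ideal. -/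
/-- If a proper convex combination of two nonnegative reals vanishes, both of them vanish. -/
theorem eq_zero_and_eq_zero_of_convexComb_eq_zero {t u v : ℝ} (ht₀ : 0 < t) (ht₁ : t < 1)
    (hu : 0 ≤ u) (hv : 0 ≤ v) (h : t * u + (1 - t) * v = 0) : u = 0 ∧ v = 0 := by
  have hs : 0 < 1 - t := sub_pos.mpr ht₁
  obtain ⟨h₁, h₂⟩ :=
    (add_eq_zero_iff_of_nonneg (mul_nonneg ht₀.le hu) (mul_nonneg hs.le hv)).mp h
  exact ⟨(mul_eq_zero.mp h₁).resolve_left ht₀.ne.symm, (mul_eq_zero.mp h₂).resolve_left hs.ne.symm⟩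

/-- the fractional point `(w, x₁₁, x₁₂, x₂₁, x₂₂) = (0, 1/3, 2/3, 1/3, 0)` is
an extreme point of the LP relaxation `P` of the big-M formulation (M = 15, 0 ≤ w ≤ 10) of
the two-split decision tree; in particular this big-M formulation is not ideal.
Coordinates: `q = (w, x₁₁, x₁₂, x₂₁, x₂₂)`. -/
theorem bigM_tree_not_ideal (P : Set (ℝ × ℝ × ℝ × ℝ × ℝ))
    (hP : P = {q | q.1 - 15 * (1 - q.2.1) ≤ 5 ∧
        q.1 - 15 * (1 - q.2.2.2.1) ≤ 2 ∧
        q.1 + 15 * (1 - q.2.2.1) ≥ 5 ∧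
        q.1 + 15 * (1 - q.2.2.2.2) ≥ 2 ∧
        q.2.2.2.1 + q.2.2.2.2 = q.2.1 ∧
        q.2.2.1 + q.2.2.2.1 + q.2.2.2.2 = 1 ∧
        0 ≤ q.2.1 ∧ q.2.1 ≤ 1 ∧ 0 ≤ q.2.2.1 ∧ q.2.2.1 ≤ 1 ∧
        0 ≤ q.2.2.2.1 ∧ q.2.2.2.1 ≤ 1 ∧ 0 ≤ q.2.2.2.2 ∧ q.2.2.2.2 ≤ 1 ∧
        0 ≤ q.1 ∧ q.1 ≤ 10}) :
    ((0, 1/3, 2/3, 1/3, 0) : ℝ × ℝ × ℝ × ℝ × ℝ) ∈ P ∧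
    ∀ a ∈ P, ∀ b ∈ P, ∀ t : ℝ, 0 < t → t < 1 →
      ((0, 1/3, 2/3, 1/3, 0) : ℝ × ℝ × ℝ × ℝ × ℝ) = t • a + (1 - t) • b →
      a = ((0, 1/3, 2/3, 1/3, 0) : ℝ × ℝ × ℝ × ℝ × ℝ) ∧
      b = ((0, 1/3, 2/3, 1/3, 0) : ℝ × ℝ × ℝ × ℝ × ℝ) := by
  subst hP
  refine ⟨by norm_num, ?_⟩
  rintro ⟨a₁, a₂, a₃, a₄, a₅⟩ ⟨-, -, ha, -, ha₄, ha₃, -, -, -, -, -, -, ha₅, -, ha₁, -⟩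
    ⟨b₁, b₂, b₃, b₄, b₅⟩ ⟨-, -, hb, -, hb₄, hb₃, -, -, -, -, -, -, hb₅, -, hb₁, -⟩ t ht₀ ht₁ h
  simp only [Prod.smul_mk, Prod.mk_add_mk, smul_eq_mul, Prod.mk.injEq] at *
  obtain ⟨h₁, -, h₃, -, h₅⟩ := h
  -- The tight inequalities are `0 ≤ w`, `0 ≤ x₂₂` and `w + 15 (1 - x₁₂) ≥ 5`.
  obtain ⟨hw, hw'⟩ := eq_zero_and_eq_zero_of_convexComb_eq_zero ht₀ ht₁ ha₁ hb₁ h₁.symm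
  obtain ⟨hx, hx'⟩ := eq_zero_and_eq_zero_of_convexComb_eq_zero ht₀ ht₁ ha₅ hb₅ h₅.symm
  obtain ⟨hy, hy'⟩ := eq_zero_and_eq_zero_of_convexComb_eq_zero ht₀ ht₁
    (sub_nonneg.mpr ha) (sub_nonneg.mpr hb) (by linear_combination 15 * h₃ - h₁)
  refine ⟨⟨?_, ?_, ?_, ?_, ?_⟩, ?_, ?_, ?_, ?_, ?_⟩ <;> linarith
end

section
/- Consider the polyhedron P = {(w, y, z^1_1, z^1_2, z^2_1, z^2_2) ∈ ℝ^6 : z^1_2 ≤ w, 2 z^2_2 ≤ w, z^1_1 + 3 z^1_2 ≥ w, 2 z^2_1 + 3 z^2_2 ≥ w, y = (z^1_1 + 4 z^1_2 + 2 z^2_1 + 3 z^2_2)/2, z^1_1 + z^1_2 = 1, z^2_1 + z^2_2 = 1, z^1_1, z^1_2, z^2_1, z^2_2 ≥ 0, w ≥ 0}. Then: (i) the point (w, y, z^1_1, z^1_2, z^2_1, z^2_2) = (1, 13/4, 0, 1, 1/2, 1/2) is an extreme point of P, so the formulation of this two-tree ensemble is not ideal; and (ii) the point (1, 13/4) does not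 belong to the convex hull of the graph G = {(w, F(w)) : 0 ≤ w ≤ 3}, where F(w) = 3/2 for 0 ≤ w ≤ 1, F(w) = 3 for 1 < w ≤ 2, and F(w) = 7/2 for 2 < w ≤ 3, so the formulation is not sharp. -/
/-- If a proper convex combination of two numbers `x, y ≥ c` equals `c`, then `x = y = c`. -/
theorem eq_and_eq_of_convex_combination_eq {t x y c : ℝ} (ht₀ : 0 < t) (ht₁ : t < 1)
    (hx : c ≤ x) (hy : c ≤ y) (h : c = t * x + (1 - t) * y) : x = c ∧ y = c := by
  have hx' : 0 ≤ t * (x - c) := mul_nonneg ht₀.le (sub_nonneg.2 hx)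
  have hy' : 0 ≤ (1 - t) * (y - c) := mul_nonneg (sub_pos.2 ht₁).le (sub_nonneg.2 hy)
  have hx₀ : t * (x - c) = 0 := by linarith
  have hy₀ : (1 - t) * (y - c) = 0 := by linarith
  exact ⟨sub_eq_zero.1 ((mul_eq_zero.1 hx₀).resolve_left ht₀.ne'),
    sub_eq_zero.1 ((mul_eq_zero.1 hy₀).resolve_left (sub_pos.2 ht₁).ne')⟩

/-- for the union-of-polyhedra (projected) formulation `P` of the two-tree
ensemble, (i) the point `(w, y, z¹₁, z¹₂, z²₁, z²₂) = (1, 13/4, 0, 1, 1/2, 1/2)` is an extreme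
point of `P` (so the formulation is not ideal), and (ii) the projected point `(1, 13/4)` does
not belong to the convex hull of the graph of the ensemble prediction `F` on `[0, 3]`, where
`F w = 3/2` for `0 ≤ w ≤ 1`, `F w = 3` for `1 < w ≤ 2`, `F w = 7/2` for `2 < w ≤ 3` (so the
formulation is not sharp). Coordinates: `q = (w, y, z¹₁, z¹₂, z²₁, z²₂)`. -/
theorem two_tree_ensemble_not_ideal_not_sharp (P : Set (ℝ × ℝ × ℝ × ℝ × ℝ × ℝ))
    (hP : P = {q | q.2.2.2.1 ≤ q.1 ∧
        2 * q.2.2.2.2.2 ≤ q.1 ∧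
        q.2.2.1 + 3 * q.2.2.2.1 ≥ q.1 ∧
        2 * q.2.2.2.2.1 + 3 * q.2.2.2.2.2 ≥ q.1 ∧
        q.2.1 = (q.2.2.1 + 4 * q.2.2.2.1 + 2 * q.2.2.2.2.1 + 3 * q.2.2.2.2.2) / 2 ∧
        q.2.2.1 + q.2.2.2.1 = 1 ∧
        q.2.2.2.2.1 + q.2.2.2.2.2 = 1 ∧
        0 ≤ q.2.2.1 ∧ 0 ≤ q.2.2.2.1 ∧ 0 ≤ q.2.2.2.2.1 ∧ 0 ≤ q.2.2.2.2.2 ∧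
        0 ≤ q.1})
    (F : ℝ → ℝ) (hF : F = fun w => if w ≤ 1 then 3/2 else if w ≤ 2 then 3 else 7/2) :
    (((1, 13/4, 0, 1, 1/2, 1/2) : ℝ × ℝ × ℝ × ℝ × ℝ × ℝ) ∈ P ∧
      ∀ a ∈ P, ∀ b ∈ P, ∀ t : ℝ, 0 < t → t < 1 →
        ((1, 13/4, 0, 1, 1/2, 1/2) : ℝ × ℝ × ℝ × ℝ × ℝ × ℝ) = t • a + (1 - t) • b →
        a = ((1, 13/4, 0, 1, 1/2, 1/2) : ℝ × ℝ × ℝ × ℝ × ℝ × ℝ) ∧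
        b = ((1, 13/4, 0, 1, 1/2, 1/2) : ℝ × ℝ × ℝ × ℝ × ℝ × ℝ)) ∧
    ((1, 13/4) : ℝ × ℝ) ∉
      convexHull ℝ {q : ℝ × ℝ | ∃ w : ℝ, 0 ≤ w ∧ w ≤ 3 ∧ q = (w, F w)} := by
  subst hP hF
  refine ⟨⟨by norm_num, ?_⟩, fun hmem => ?_⟩
  · rintro ⟨w, y, z₁, z₂, u₁, u₂⟩ ha ⟨w', y', z₁', z₂', u₁', u₂'⟩ hb t ht₀ ht₁ h
    simp only [Set.mem_ofPred_eq] at ha hb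
    simp only [Prod.smul_mk, Prod.mk_add_mk, Prod.mk.injEq, smul_eq_mul] at h ⊢
    obtain ⟨ha₁, ha₂, -, -, ha₅, ha₆, ha₇, ha₈, -⟩ := ha
    obtain ⟨hb₁, hb₂, -, -, hb₅, hb₆, hb₇, hb₈, -⟩ := hb
    obtain ⟨hw, -, hz, -, hu, -⟩ := h
    obtain ⟨rfl, rfl⟩ := eq_and_eq_of_convex_combination_eq ht₀ ht₁ ha₈ hb₈ hz
    obtain ⟨rfl, rfl⟩ := eq_and_eq_of_convex_combination_eq ht₀ ht₁
      (by linarith) (by linarith) hw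
    obtain ⟨rfl, rfl⟩ := eq_and_eq_of_convex_combination_eq ht₀ ht₁
      (by linarith) (by linarith) hu
    refine ⟨⟨rfl, ?_, rfl, ?_, rfl, ?_⟩, rfl, ?_, rfl, ?_, rfl, ?_⟩ <;> linarith
  · -- The half-plane `y ≤ 3/2 + 3/2 * w` contains the graph of `F` but not `(1, 13/4)`.
    have hconv : Convex ℝ {q : ℝ × ℝ | q.2 - 3 / 2 * q.1 ≤ 3 / 2} :=
      convex_halfSpace_le
        (LinearMap.snd ℝ ℝ ℝ - (3 / 2 : ℝ) • LinearMap.fst ℝ ℝ ℝ).isLinear (3 / 2)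
    have hle := convexHull_min (fun q hq => ?_) hconv hmem
    · norm_num at hle
    · obtain ⟨w, hw₀, -, rfl⟩ := hq
      simp only [Set.mem_ofPred_eq]
      split_ifs <;> linarith
end

section
/- Let P_1 = {(x_1, x_2, z) ∈ ℝ^3 : z ≤ x_1, z ≤ 1 − x_2, x_2 ≤ x_1, 0 ≤ x_1 ≤ 1, 0 ≤ x_2 ≤ 1, 0 ≤ z} and P_2 = {(x_1, x_2, z) ∈ ℝ^3 : z ≤ x_1 − x_2, 0 ≤ x_1 ≤ 1, 0 ≤ x_2 ≤ 1, 0 ≤ z}. Then the point (1/2, 1/2, 1/2) is an extreme point of P_1, whereas every extreme point of P_2 has all three coordinates in {0,1}. -/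
theorem eq_zero_of_pos_mul_add_pos_mul_eq_zero {s t a b : ℝ} (hs : 0 < s) (ht : 0 < t)
    (ha : 0 ≤ a) (hb : 0 ≤ b) (h : s * a + t * b = 0) : a = 0 ∧ b = 0 := by
  obtain ⟨h₁, h₂⟩ := (add_eq_zero_iff_of_nonneg (by positivity) (by positivity)).1 h
  exact ⟨(mul_eq_zero.1 h₁).resolve_left hs.ne', (mul_eq_zero.1 h₂).resolve_left ht.ne'⟩

theorem mul_self_eq_self_iff {x : ℝ} : x * x = x ↔ x = 0 ∨ x = 1 :=
  IsIdempotentElem.iff_eq_zero_or_one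

/-- for the nested-split relaxations, the point `(1/2, 1/2, 1/2)` is an extreme
point of `P₁ = {(x₁, x₂, z) : z ≤ x₁, z ≤ 1 − x₂, x₂ ≤ x₁, 0 ≤ x₁ ≤ 1, 0 ≤ x₂ ≤ 1, 0 ≤ z}`,
whereas every extreme point of the elbow relaxation
`P₂ = {(x₁, x₂, z) : z ≤ x₁ − x₂, 0 ≤ x₁ ≤ 1, 0 ≤ x₂ ≤ 1, 0 ≤ z}` has all three coordinates
in `{0, 1}`. Coordinates: `q = (x₁, x₂, z)`. -/
theorem elbow_removes_fractional_extreme_point (P1 P2 : Set (ℝ × ℝ × ℝ))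
    (hP1 : P1 = {q | q.2.2 ≤ q.1 ∧ q.2.2 ≤ 1 - q.2.1 ∧ q.2.1 ≤ q.1 ∧
        0 ≤ q.1 ∧ q.1 ≤ 1 ∧ 0 ≤ q.2.1 ∧ q.2.1 ≤ 1 ∧ 0 ≤ q.2.2})
    (hP2 : P2 = {q | q.2.2 ≤ q.1 - q.2.1 ∧
        0 ≤ q.1 ∧ q.1 ≤ 1 ∧ 0 ≤ q.2.1 ∧ q.2.1 ≤ 1 ∧ 0 ≤ q.2.2}) :
    (((1/2, 1/2, 1/2) : ℝ × ℝ × ℝ) ∈ P1 ∧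
      ∀ a ∈ P1, ∀ b ∈ P1, ∀ t : ℝ, 0 < t → t < 1 →
        ((1/2, 1/2, 1/2) : ℝ × ℝ × ℝ) = t • a + (1 - t) • b →
        a = ((1/2, 1/2, 1/2) : ℝ × ℝ × ℝ) ∧ b = ((1/2, 1/2, 1/2) : ℝ × ℝ × ℝ)) ∧
    (∀ v ∈ P2,
      (∀ a ∈ P2, ∀ b ∈ P2, ∀ t : ℝ, 0 < t → t < 1 →
        v = t • a + (1 - t) • b → a = v ∧ b = v) →
      (v.1 = 0 ∨ v.1 = 1) ∧ (v.2.1 = 0 ∨ v.2.1 = 1) ∧ (v.2.2 = 0 ∨ v.2.2 = 1)) := by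
  subst hP1 hP2
  refine ⟨⟨by norm_num, ?_⟩, ?_⟩
  · rintro ⟨a₁, a₂, a₃⟩ ⟨ha₁, ha₂, ha₃, -⟩ ⟨b₁, b₂, b₃⟩ ⟨hb₁, hb₂, hb₃, -⟩ t ht₀ ht₁ h
    simp only [Prod.smul_mk, Prod.mk_add_mk, Prod.mk.injEq, smul_eq_mul] at *
    obtain ⟨h₁, h₂, h₃⟩ := h
    have ht₁' : 0 < 1 - t := sub_pos.2 ht₁
    -- The three constraints tight at the midpoint are tight at both endpoints.
    obtain ⟨p₁, q₁⟩ := eq_zero_of_pos_mul_add_pos_mul_eq_zero ht₀ ht₁' (sub_nonneg.2 ha₁)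
      (sub_nonneg.2 hb₁) (by linarith)
    obtain ⟨p₂, q₂⟩ := eq_zero_of_pos_mul_add_pos_mul_eq_zero ht₀ ht₁' (sub_nonneg.2 ha₂)
      (sub_nonneg.2 hb₂) (by linarith)
    obtain ⟨p₃, q₃⟩ := eq_zero_of_pos_mul_add_pos_mul_eq_zero ht₀ ht₁' (sub_nonneg.2 ha₃)
      (sub_nonneg.2 hb₃) (by linarith)
    refine ⟨⟨?_, ?_, ?_⟩, ?_, ?_, ?_⟩ <;> linarith
  · rintro ⟨x, y, z⟩ ⟨h, hx₀, hx₁, hy₀, hy₁, hz₀⟩ hv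
    dsimp only at *
    -- Move along the line through `v` and the vertex `(0, 0, 0)`.
    have hx : x = 0 ∨ x = 1 := by
      have key := (hv (x * (2 - x), y * (2 - x), z * (2 - x))
        ⟨by dsimp only; nlinarith, by dsimp only; nlinarith, by dsimp only; nlinarith,
          by dsimp only; nlinarith, by dsimp only; nlinarith, by dsimp only; nlinarith⟩
        (x * x, y * x, z * x)
        ⟨by dsimp only; nlinarith, by dsimp only; nlinarith, by dsimp only; nlinarith,
          by dsimp only; nlinarith, by dsimp only; nlinarith, by dsimp only; nlinarith⟩
        (1 / 2) (by norm_num) (by norm_num)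
        (by ext <;> simp <;> ring)).2
      exact mul_self_eq_self_iff.1 (congrArg Prod.fst key)
    rcases hx with rfl | rfl
    · exact ⟨.inl rfl, .inl (by linarith), .inl (by linarith)⟩
    -- Within the facet `x = 1`, move along the line through `v` and the vertex `(1, 1, 0)`.
    have hy : y = 0 ∨ y = 1 := by
      have key := (hv (1, y * (2 - y), z * (1 - y))
        ⟨by dsimp only; nlinarith, by norm_num, by norm_num,
          by dsimp only; nlinarith, by dsimp only; nlinarith, by dsimp only; nlinarith⟩
        (1, y * y, z * (1 + y))
        ⟨by dsimp only; nlinarith, by norm_num, by norm_num,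
          by dsimp only; nlinarith, by dsimp only; nlinarith, by dsimp only; nlinarith⟩
        (1 / 2) (by norm_num) (by norm_num)
        (by ext <;> simp <;> ring)).2
      exact mul_self_eq_self_iff.1 (congrArg (fun q => q.2.1) key)
    rcases hy with rfl | rfl
    · have key := (hv (1, 0, z * (2 - z))
        ⟨by dsimp only; nlinarith, by norm_num, by norm_num, by norm_num, by norm_num,
          by dsimp only; nlinarith⟩
        (1, 0, z * z)
        ⟨by dsimp only; nlinarith, by norm_num, by norm_num, by norm_num, by norm_num,
          by dsimp only; nlinarith⟩
        (1 / 2) (by norm_num) (by norm_num)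
        (by ext <;> simp; ring)).2
      exact ⟨.inr rfl, .inl rfl, mul_self_eq_self_iff.1 (congrArg (fun q => q.2.2) key)⟩
    · exact ⟨.inr rfl, .inr rfl, .inl (by linarith)⟩
end

section
/- For every l ∈ {1,…,p} let L_l = {w ∈ ℝ^d : b_{l,i} ≤ w_i ≤ u_{l,i} for all i ∈ {1,…,d}}. Then {(w, y) ∈ ℝ^d × ℝ : there exists z ∈ {0,1}^p with (w, y, z) ∈ Q^proj} = ⋃_{l=1}^p (L_l × {s_l}). In particular, if the boxes L_1, …, L_p are pairwise disjoint with union D and f : D → ℝ is the decision-tree prediction defined by f(w) = s_l for w ∈ L_l, then the projection onto (w, y) of the mixed-integer feasible set of Q^proj equals the graph {(w, f(w)) : w ∈ D}, i.e., Q^proj is a valid mixed-integer formulation of the tree. -/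
open Finset

/-- A binary vector whose entries sum to one is a standard basis vector. -/
theorem exists_eq_single_of_binary_of_sum_eq_one {ι : Type*} [Fintype ι] [DecidableEq ι]
    {z : ι → ℝ} (hz : ∀ l, z l = 0 ∨ z l = 1) (hsum : ∑ l, z l = 1) :
    ∃ l, z = Pi.single l 1 := by
  obtain ⟨l, -, hl⟩ : ∃ l ∈ univ, z l ≠ 0 :=
    exists_ne_zero_of_sum_ne_zero (by rw [hsum]; exact one_ne_zero)
  have hl1 : z l = 1 := (hz l).resolve_left hl
  have hnonneg : ∀ m, 0 ≤ z m := fun m => by rcases hz m with h | h <;> simp [h]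
  have hrest : ∑ m ∈ univ.erase l, z m = 0 := by
    have := add_sum_erase univ z (mem_univ l)
    linarith
  refine ⟨l, funext fun m => ?_⟩
  rcases eq_or_ne m l with rfl | hm
  · simpa using hl1
  · rw [Pi.single_eq_of_ne hm]
    exact (sum_eq_zero_iff_of_nonneg fun m _ => hnonneg m).1 hrest m (by simp [hm])

/-- the projection onto `(w, y)` of the mixed-integer feasible set of `Qproj`
(binary `z`) equals the union `⋃ l, L l × {s l}` of the leaf boxes with their scores; in
particular, if the boxes are pairwise disjoint with union `D` and `f` is the decision-tree
prediction taking value `s l` on `L l`, then this projection equals the graph of `f` on `D`,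
i.e. `Qproj` is a valid mixed-integer formulation of the tree. -/
theorem qproj_valid_formulation (d p : ℕ) (hd : 0 < d) (hp : 0 < p)
    (u b : Fin p → Fin d → ℝ) (s : Fin p → ℝ)
    (L : Fin p → Set (Fin d → ℝ))
    (hL : L = fun l => {w | ∀ i, b l i ≤ w i ∧ w i ≤ u l i})
    (Qproj : Set ((Fin d → ℝ) × ℝ × (Fin p → ℝ)))
    (hQ : Qproj = {q | (∀ i, q.1 i ≤ ∑ l, u l i * q.2.2 l) ∧
        (∀ i, ∑ l, b l i * q.2.2 l ≤ q.1 i) ∧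
        (q.2.1 = ∑ l, s l * q.2.2 l) ∧
        (∑ l, q.2.2 l = 1) ∧
        (∀ l, 0 ≤ q.2.2 l ∧ q.2.2 l ≤ 1)}) :
    ({q : (Fin d → ℝ) × ℝ | ∃ z : Fin p → ℝ, (∀ l, z l = 0 ∨ z l = 1) ∧ (q.1, q.2, z) ∈ Qproj}
      = ⋃ l, L l ×ˢ ({s l} : Set ℝ)) ∧
    (∀ (D : Set (Fin d → ℝ)) (f : (Fin d → ℝ) → ℝ),
      (∀ l l' : Fin p, l ≠ l' → Disjoint (L l) (L l')) →
      (⋃ l, L l) = D →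
      (∀ l, ∀ w ∈ L l, f w = s l) →
      {q : (Fin d → ℝ) × ℝ | ∃ z : Fin p → ℝ, (∀ l, z l = 0 ∨ z l = 1) ∧ (q.1, q.2, z) ∈ Qproj}
        = {q : (Fin d → ℝ) × ℝ | q.1 ∈ D ∧ q.2 = f q.1}) := by
  have hunion : {q : (Fin d → ℝ) × ℝ | ∃ z : Fin p → ℝ,
      (∀ l, z l = 0 ∨ z l = 1) ∧ (q.1, q.2, z) ∈ Qproj} = ⋃ l, L l ×ˢ ({s l} : Set ℝ) := by
    subst hL hQ
    ext ⟨w, y⟩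
    simp only [Set.mem_ofPred_eq, Set.mem_iUnion, Set.mem_prod, Set.mem_singleton_iff]
    constructor
    · rintro ⟨z, hz, hu, hb, hy, hsum, -⟩
      obtain ⟨l, rfl⟩ := exists_eq_single_of_binary_of_sum_eq_one hz hsum
      simp only [Pi.single_apply, mul_ite, mul_one, mul_zero, sum_ite_eq', mem_univ,
        if_true] at hu hb hy
      exact ⟨l, fun i => ⟨hb i, hu i⟩, hy⟩
    · rintro ⟨l, hw, hy⟩
      have hbinary : ∀ m, (Pi.single l 1 : Fin p → ℝ) m = 0 ∨
          (Pi.single l 1 : Fin p → ℝ) m = 1 := fun m => by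
        rcases eq_or_ne m l with rfl | hm <;> simp [*]
      refine ⟨Pi.single l 1, hbinary, fun i => ?_, fun i => ?_, ?_, ?_, fun m => ?_⟩
      · simpa [Pi.single_apply] using (hw i).2
      · simpa [Pi.single_apply] using (hw i).1
      · simpa [Pi.single_apply] using hy
      · simp
      · rcases hbinary m with h | h <;> simp [h]
  refine ⟨hunion, fun D f _ hD hf => ?_⟩
  rw [hunion, ← hD]
  ext ⟨w, y⟩
  simp only [Set.mem_ofPred_eq, Set.mem_iUnion, Set.mem_prod, Set.mem_singleton_iff]
  constructor
  · rintro ⟨l, hw, hy⟩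
    exact ⟨⟨l, hw⟩, hy.trans (hf l w hw).symm⟩
  · rintro ⟨⟨l, hw⟩, hy⟩
    exact ⟨l, hw, hy.trans (hf l w hw)⟩
end
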